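/- arXiv:2403.02492 — 2 statements merged into one kernel-verified Lean document; each statement's English description precedes it below -/
import Mathlib

section
/- The set {i ∈ ℕ : E_i is computably equivalent to the word problem of some recursively presented group} is Σ⁰₃-complete: it is Σ⁰₃ and every Σ⁰₃ subset of ℕ many-one reduces to it. -/
/-- The `e`-th computably enumerable subset of `ℕ`: the domain of the `e`-th partial
computable function. -/
def W (e : ℕ) : Set ℕ := {n | ((Denumerable.ofNat Nat.Partrec.Code e).eval n).Dom}

/-- A set `S ⊆ ℕ` is Σ⁰₃ if there is a computable predicate `R ⊆ ℕ⁴` with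
`n ∈ S ↔ ∃x ∀y ∃z, R n x y z`. -/
def IsSigma03 (S : Set ℕ) : Prop :=
  ∃ R : ℕ → ℕ → ℕ → ℕ → Bool,
    (Computable fun p : ℕ × ℕ × ℕ × ℕ => R p.1 p.2.1 p.2.2.1 p.2.2.2) ∧
    ∀ n, n ∈ S ↔ ∃ x, ∀ y, ∃ z, R n x y z = true

/-- A binary relation on `ℕ` is Σ⁰₃ if the corresponding set of codes of pairs
(under the standard computable pairing) is Σ⁰₃. -/
def Sigma03Rel (E : ℕ → ℕ → Prop) : Prop :=
  IsSigma03 {p : ℕ | E p.unpair.1 p.unpair.2}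

/-- `E` computably reduces to `F`: there is a total computable `Φ` with
`m E n ↔ Φ(m) F Φ(n)`. -/
def ComputableReduction (E F : ℕ → ℕ → Prop) : Prop :=
  ∃ Φ : ℕ → ℕ, Computable Φ ∧ ∀ m n, E m n ↔ F (Φ m) (Φ n)

/-- `E` and `F` are computably equivalent: computable reductions exist in both directions. -/
def CeerEquiv (E F : ℕ → ℕ → Prop) : Prop :=
  ComputableReduction E F ∧ ComputableReduction F E

/-- The fixed uniform enumeration of all ceers: `ceer i` is the equivalence relation
generated by the `i`-th c.e. set `W i` of coded pairs. -/
def ceer (i : ℕ) : ℕ → ℕ → Prop :=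
  Relation.EqvGen fun m n => Nat.pair m n ∈ W i

/-- `[S]`: the closure of a set of indices of ceers under computable equivalence. -/
def ceerClosure (S : Set ℕ) : Set ℕ := {i | ∃ j ∈ S, CeerEquiv (ceer i) (ceer j)}

/-- An equivalence relation on `ℕ` has infinitely many classes iff there is an infinite
family of pairwise inequivalent elements. -/
def HasInfinitelyManyClasses (E : ℕ → ℕ → Prop) : Prop :=
  ∃ f : ℕ → ℕ, ∀ m n, m ≠ n → ¬E (f m) (f n)

/-- `S` is proper on the infinite ceers: some ceer with infinitely many classes has its
index in `[S]` and some ceer with infinitely many classes has its index outside `[S]`. -/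
def ProperOnInfiniteCeers (S : Set ℕ) : Prop :=
  ∃ i j, HasInfinitelyManyClasses (ceer i) ∧ HasInfinitelyManyClasses (ceer j) ∧
    i ∈ ceerClosure S ∧ j ∉ ceerClosure S

/-- Code of an element of the free group on a set `X ⊆ ℕ` of generators, via its reduced
word (with each generator coded by its value in `ℕ`). -/
def encodeFGX {X : Set ℕ} (g : FreeGroup X) : ℕ :=
  Encodable.encode (g.toWord.map fun p => ((p.1 : ℕ), p.2))

/-- The relator set over generators `X ⊆ ℕ` given by the `e`-th c.e. set: elements of the
free group on `X` whose codes lie in `W e`. -/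
def relSetX (X : Set ℕ) (e : ℕ) : Set (FreeGroup X) := {g | encodeFGX g ∈ W e}

/-- Decode a natural number as an element of the free group on generators `X ⊆ ℕ`. -/
noncomputable def decodeWordX (X : Set ℕ) (m : ℕ) : FreeGroup X :=
  FreeGroup.mk
    (((Encodable.decode (α := List (ℕ × Bool)) m).getD []).filterMap fun p =>
      @dite _ (p.1 ∈ X) (Classical.dec _) (fun h => some ((⟨p.1, h⟩ : X), p.2)) fun _ => none)

/-- The word problem of the recursively presented group `⟨X ∣ relSetX X e⟩`: the
equivalence relation on `ℕ` identifying codes of words whose images in the group coincide. -/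
def wordProblemX (X : Set ℕ) (e : ℕ) : ℕ → ℕ → Prop := fun m n =>
  PresentedGroup.mk (relSetX X e) (decodeWordX X m) =
    PresentedGroup.mk (relSetX X e) (decodeWordX X n)

/-- The set of indices `i` such that `E_i` is computably equivalent to the word problem of
some recursively presented group `⟨X ∣ R_e⟩` with `X` a computable set of generators. -/
def RPWordProblemIndices : Set ℕ :=
  {i | ∃ X : Set ℕ, ComputablePred (· ∈ X) ∧ ∃ e, CeerEquiv (ceer i) (wordProblemX X e)}

open Nat.Partrec (Code)
open Encodable Denumerable

section RE

variable {α β : Type} [Primcodable α] [Primcodable β]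

theorem rePred_of_exists {p : α → Prop} {R : α × ℕ → Bool} (hR : Computable R)
    (h : ∀ a, p a ↔ ∃ z, R (a, z) = true) : REPred p := by
  have hf : Partrec fun a : α => Nat.rfind fun z => (Part.some (R (a, z)) : Part Bool) :=
    Partrec.rfind hR.partrec.to₂
  refine hf.dom_re.of_eq fun a => ?_
  refine Nat.rfind_dom'.trans (Iff.trans ?_ (h a).symm)
  constructor
  · rintro ⟨n, hn, -⟩
    exact ⟨n, by simpa using hn⟩
  · rintro ⟨n, hn⟩
    exact ⟨n, by simp [hn], fun _ => trivial⟩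

theorem rePred_iff_exists {p : α → Prop} :
    REPred p ↔ ∃ R : α × ℕ → Bool, Computable R ∧ ∀ a, p a ↔ ∃ z, R (a, z) = true := by
  refine ⟨fun hp => ?_, fun ⟨R, hR, h⟩ => rePred_of_exists hR h⟩
  obtain ⟨c, hc⟩ := Code.exists_code.1 hp
  refine ⟨fun x => (Code.evaln x.2 c (encode x.1)).isSome, ?_, fun a => ?_⟩
  · exact Primrec.option_isSome.to_comp.comp (Code.primrec_evaln.to_comp.comp
      ((Computable.snd.pair (Computable.const c)).pair (Computable.encode.comp Computable.fst)))
  · have h : p a ↔ (c.eval (encode a)).Dom := by simp [hc, Part.assert]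
    simp only [h, Part.dom_iff_mem, Code.evaln_complete, Option.isSome_iff_exists, Option.mem_def]
    exact exists_comm

theorem REPred.comp {p : β → Prop} (hp : REPred p) {f : α → β} (hf : Computable f) :
    REPred fun a => p (f a) :=
  Partrec.comp (f := fun b => Part.assert (p b) fun _ => Part.some ()) hp hf

theorem REPred.and {p q : α → Prop} (hp : REPred p) (hq : REPred q) :
    REPred fun a => p a ∧ q a := by
  have h : Partrec fun a => (Part.assert (p a) fun _ => Part.some ()).bind
      fun _ => Part.assert (q a) fun _ => Part.some () :=
    Partrec.bind hp (Partrec.comp (f := fun a => Part.assert (q a) fun _ => Part.some ())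
      hq Computable.fst).to₂
  exact h.dom_re.of_eq fun a => by simp [Part.assert]

theorem REPred.or {p q : α → Prop} (hp : REPred p) (hq : REPred q) :
    REPred fun a => p a ∨ q a := by
  obtain ⟨k, hk, h⟩ := Partrec.merge' hp hq
  exact hk.dom_re.of_eq fun a => by simpa [Part.assert] using (h a).2

theorem REPred.exists {p : α → β → Prop} (hp : REPred fun x : α × β => p x.1 x.2) :
    REPred fun a => ∃ b, p a b := by
  obtain ⟨R, hR, h⟩ := rePred_iff_exists.1 hp
  refine rePred_of_exists (R := fun x : α × ℕ =>
    ((decode (α := β) x.2.unpair.1).map fun b => R ((x.1, b), x.2.unpair.2)).getD false)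
    ?_ fun a => ?_
  · refine Computable.option_getD (Computable.option_map (Computable.decode.comp
      (Computable.fst.comp (Computable.unpair.comp Computable.snd))) ?_) (Computable.const _)
    exact hR.comp (((Computable.fst.comp Computable.fst).pair Computable.snd).pair
      (Computable.snd.comp (Computable.unpair.comp (Computable.snd.comp Computable.fst)))) |>.to₂
  · constructor
    · rintro ⟨b, hb⟩
      obtain ⟨z, hz⟩ := (h (a, b)).1 hb
      exact ⟨Nat.pair (encode b) z, by simpa using hz⟩
    · rintro ⟨z, hz⟩
      cases hb : decode (α := β) z.unpair.1 with
      | none => simp [hb] at hz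
      | some b => exact ⟨b, (h (a, b)).2 ⟨_, by simpa [hb] using hz⟩⟩

theorem REPred.forall_lt {p : α → ℕ → Prop} (hp : REPred fun x : α × ℕ => p x.1 x.2) :
    REPred fun x : α × ℕ => ∀ y < x.2, p x.1 y := by
  have h : Partrec fun x : α × ℕ => (Nat.rec (Part.some ())
      (fun y ih => ih.bind fun _ => Part.assert (p x.1 y) fun _ => Part.some ()) x.2 :
        Part Unit) := by
    refine Partrec.nat_rec (f := fun x : α × ℕ => x.2)
      (h := fun x z => Part.assert (p x.1 z.1) fun _ => Part.some ())
      Computable.snd (Computable.const ()).partrec ?_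
    exact REPred.comp hp ((Computable.fst.comp Computable.fst).pair
      (Computable.fst.comp Computable.snd))
  refine h.dom_re.of_eq fun ⟨a, n⟩ => ?_
  induction n with
  | zero => simp
  | succ n ih =>
    simp only [Part.bind_dom, Part.assert] at ih ⊢
    simp only [exists_prop, ih, Nat.forall_lt_succ_right]
    simp

end RE

theorem rePred_mem_W : REPred fun x : ℕ × ℕ => x.2 ∈ W x.1 :=
  (Code.eval_part.comp ((Computable.ofNat Code).comp Computable.fst) Computable.snd).dom_re

theorem exists_index {p : ℕ → ℕ → Prop} (hp : REPred fun x : ℕ × ℕ => p x.1 x.2) :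
    ∃ f : ℕ → ℕ, Computable f ∧ ∀ n m, m ∈ W (f n) ↔ p n m := by
  have h : REPred fun x : ℕ => p x.unpair.1 x.unpair.2 := REPred.comp hp Computable.unpair
  obtain ⟨c, hc⟩ := Code.exists_code.1 h
  refine ⟨fun n => encode (c.curry n), ?_, fun n m => ?_⟩
  · exact Computable.encode.comp
      (Code.primrec₂_curry.to_comp.comp (Computable.const c) Computable.id)
  · simp [W, Code.eval_curry, hc, Part.assert]

theorem exists_index_of_rePred {p : ℕ → Prop} (hp : REPred p) : ∃ e, ∀ m, m ∈ W e ↔ p m := by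
  obtain ⟨f, -, hf⟩ := exists_index (p := fun _ m => p m) (hp.comp Computable.snd)
  exact ⟨f 0, hf 0⟩

theorem rePred_mem_eval : REPred fun x : Code × ℕ × ℕ => x.2.2 ∈ x.1.eval x.2.1 := by
  refine rePred_of_exists (R := fun x : (Code × ℕ × ℕ) × ℕ =>
    decide (Code.evaln x.2 x.1.1 x.1.2.1 = some x.1.2.2)) ?_ fun a => ?_
  · refine (Primrec.eq (α := Option ℕ)).decide.to_comp.comp ?_ ?_
    · exact Code.primrec_evaln.to_comp.comp
        ((Computable.snd.pair (Computable.fst.comp Computable.fst)).pair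
          (Computable.fst.comp (Computable.snd.comp Computable.fst)))
    · exact Computable.option_some.comp
        (Computable.snd.comp (Computable.snd.comp Computable.fst))
  · simp [Code.evaln_complete]

theorem isSigma03_of_rePred {β : Type} [Primcodable β] {S : Set ℕ}
    {p : ℕ × β × ℕ → Prop} (hp : REPred p) (h : ∀ n, n ∈ S ↔ ∃ x, ∀ y, p (n, x, y)) :
    IsSigma03 S := by
  have hq : REPred fun a : ℕ × ℕ × ℕ => ∃ b : β, encode b = a.2.1 ∧ p (a.1, b, a.2.2) := by
    refine REPred.exists (p := fun (a : ℕ × ℕ × ℕ) (b : β) => encode b = a.2.1 ∧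
      p (a.1, b, a.2.2)) (REPred.and ?_ ?_)
    · exact (Computable.computablePred ((Primrec.eq (α := ℕ)).decide.to_comp.comp
        (Computable.encode.comp Computable.snd)
        (Computable.fst.comp (Computable.snd.comp Computable.fst)))).to_re
    · exact hp.comp ((Computable.fst.comp Computable.fst).pair
        (Computable.snd.pair (Computable.snd.comp (Computable.snd.comp Computable.fst))))
  obtain ⟨R, hR, hRq⟩ := rePred_iff_exists.1 hq
  refine ⟨fun n x y z => R ((n, x, y), z), ?_, fun n => ?_⟩
  · refine hR.comp ((Computable.fst.pair ((Computable.fst.comp Computable.snd).pair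
      (Computable.fst.comp (Computable.snd.comp Computable.snd)))).pair
      (Computable.snd.comp (Computable.snd.comp Computable.snd)))
  · simp only [← hRq, h]
    constructor
    · rintro ⟨x, hx⟩
      exact ⟨encode x, fun y => ⟨x, rfl, hx y⟩⟩
    · rintro ⟨k, hk⟩
      obtain ⟨x, hx, -⟩ := hk 0
      refine ⟨x, fun y => ?_⟩
      obtain ⟨x', hx', h'⟩ := hk y
      rwa [← encode_injective (hx'.trans hx.symm)]

theorem rePred_eqvGen {α : Type} [Primcodable α] {r : α → ℕ → ℕ → Prop}
    (hr : REPred fun x : α × ℕ × ℕ => r x.1 x.2.1 x.2.2) :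
    REPred fun x : α × ℕ × ℕ => Relation.EqvGen (r x.1) x.2.1 x.2.2 := by
  have hlink : REPred fun x : (α × List ℕ) × ℕ =>
      r x.1.1 (x.1.2.getD x.2 0) (x.1.2.getD (x.2 + 1) 0) ∨
        r x.1.1 (x.1.2.getD (x.2 + 1) 0) (x.1.2.getD x.2 0) := by
    have hg : Computable fun x : (α × List ℕ) × ℕ => x.1.2.getD x.2 0 :=
      (Primrec.list_getD 0).to_comp.comp (Computable.snd.comp Computable.fst) Computable.snd
    have hg' : Computable fun x : (α × List ℕ) × ℕ => x.1.2.getD (x.2 + 1) 0 :=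
      (Primrec.list_getD 0).to_comp.comp (Computable.snd.comp Computable.fst)
        (Computable.succ.comp Computable.snd)
    have ha : Computable fun x : (α × List ℕ) × ℕ => x.1.1 := Computable.fst.comp Computable.fst
    exact (hr.comp (ha.pair (hg.pair hg'))).or (hr.comp (ha.pair (hg'.pair hg)))
  have hchain := REPred.forall_lt (p := fun (a : α × List ℕ) j =>
    r a.1 (a.2.getD j 0) (a.2.getD (j + 1) 0) ∨ r a.1 (a.2.getD (j + 1) 0) (a.2.getD j 0)) hlink
  have hex : REPred fun x : α × ℕ × ℕ => ∃ b : List ℕ × ℕ,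
      (x.2.1 = b.1.getD 0 0 ∧ x.2.2 = b.1.getD b.2 0) ∧ ∀ j < b.2,
        r x.1 (b.1.getD j 0) (b.1.getD (j + 1) 0) ∨
          r x.1 (b.1.getD (j + 1) 0) (b.1.getD j 0) := by
    refine REPred.exists (p := fun (x : α × ℕ × ℕ) (b : List ℕ × ℕ) =>
      (x.2.1 = b.1.getD 0 0 ∧ x.2.2 = b.1.getD b.2 0) ∧ ∀ j < b.2,
        r x.1 (b.1.getD j 0) (b.1.getD (j + 1) 0) ∨
          r x.1 (b.1.getD (j + 1) 0) (b.1.getD j 0)) (REPred.and (REPred.and ?_ ?_) ?_)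
    · exact (PrimrecPred.computablePred (Primrec.eq.comp
        (Primrec.fst.comp (Primrec.snd.comp Primrec.fst))
        ((Primrec.list_getD 0).comp (Primrec.fst.comp Primrec.snd) (Primrec.const 0)))).to_re
    · exact (PrimrecPred.computablePred (Primrec.eq.comp
        (Primrec.snd.comp (Primrec.snd.comp Primrec.fst))
        ((Primrec.list_getD 0).comp (Primrec.fst.comp Primrec.snd)
          (Primrec.snd.comp Primrec.snd)))).to_re
    · exact hchain.comp (((Computable.fst.comp Computable.fst).pair
        (Computable.fst.comp Computable.snd)).pair (Computable.snd.comp Computable.snd))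
  refine hex.of_eq fun ⟨a, m, n⟩ => ?_
  constructor
  · rintro ⟨⟨l, k⟩, ⟨h0, hk⟩, h⟩
    simp only at h0 hk h
    subst h0 hk
    induction k with
    | zero => exact .refl _
    | succ k ih =>
      refine (ih fun j hj => h j (by omega)).trans _ _ _ ?_
      rcases h k (by omega) with h | h
      · exact .rel _ _ h
      · exact (Relation.EqvGen.rel _ _ h).symm
  · intro h
    change Relation.EqvGen (r a) m n at h
    have h' : Relation.ReflTransGen (fun m n => r a m n ∨ r a n m) m n := by
      induction h with
      | rel _ _ h => exact .single (.inl h)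
      | refl => exact .refl
      | symm _ _ _ ih =>
        have : Std.Symm fun m n => r a m n ∨ r a n m := ⟨fun _ _ => Or.symm⟩
        exact Relation.ReflTransGen.stdSymm.symm _ _ ih
      | trans _ _ _ _ _ ih₁ ih₂ => exact ih₁.trans ih₂
    clear h
    induction h' using Relation.ReflTransGen.head_induction_on with
    | refl => exact ⟨([n], 0), by simp⟩
    | @head c d hcd _ ih =>
      obtain ⟨⟨l, k⟩, ⟨h0, hk⟩, hl⟩ := ih
      refine ⟨(c :: l, k + 1), ⟨by simp, by simpa using hk⟩, fun j hj => ?_⟩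
      cases j with
      | zero => exact h0 ▸ hcd
      | succ j => exact hl j (Nat.lt_of_succ_lt_succ hj)

theorem rePred_ceer : REPred fun x : ℕ × ℕ × ℕ => ceer x.1 x.2.1 x.2.2 := by
  refine rePred_eqvGen (r := fun i m n => Nat.pair m n ∈ W i) ?_
  exact rePred_mem_W.comp (f := fun x : ℕ × ℕ × ℕ => (x.1, Nat.pair x.2.1 x.2.2))
    (Computable.fst.pair (Primrec₂.natPair.to_comp.comp (Computable.fst.comp Computable.snd)
      (Computable.snd.comp Computable.snd)))

theorem exists_rePred_computableReduction {E F : ℕ → ℕ → ℕ → Prop}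
    (hE : REPred fun x : ℕ × ℕ × ℕ => E x.1 x.2.1 x.2.2)
    (hF : REPred fun x : ℕ × ℕ × ℕ => F x.1 x.2.1 x.2.2) :
    ∃ T : (ℕ × ℕ) × Code × ℕ → Prop, REPred T ∧
      ∀ i s, ComputableReduction (E i) (F s) ↔ ∃ c, ∀ y, T ((i, s), c, y) := by
  obtain ⟨R, hR, hRE⟩ := rePred_iff_exists.1 hE
  obtain ⟨R', hR', hRF⟩ := rePred_iff_exists.1 hF
  simp only [Prod.forall] at hRE hRF
  let T : (ℕ × ℕ) × Code × (ℕ × ℕ × ℕ) → Prop := fun x => ∃ w : ℕ × ℕ,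
    (w.1 ∈ x.2.1.eval x.2.2.1 ∧ w.2 ∈ x.2.1.eval x.2.2.2.1) ∧
    (¬ R ((x.1.1, x.2.2.1, x.2.2.2.1), x.2.2.2.2) = true ∨ F x.1.2 w.1 w.2) ∧
    (¬ R' ((x.1.2, w.1, w.2), x.2.2.2.2) = true ∨ E x.1.1 x.2.2.1 x.2.2.2.1)
  have hT : REPred T := by
    refine REPred.exists (p := fun (x : (ℕ × ℕ) × Code × (ℕ × ℕ × ℕ)) (w : ℕ × ℕ) =>
      (w.1 ∈ x.2.1.eval x.2.2.1 ∧ w.2 ∈ x.2.1.eval x.2.2.2.1) ∧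
      (¬ R ((x.1.1, x.2.2.1, x.2.2.2.1), x.2.2.2.2) = true ∨ F x.1.2 w.1 w.2) ∧
      (¬ R' ((x.1.2, w.1, w.2), x.2.2.2.2) = true ∨ E x.1.1 x.2.2.1 x.2.2.2.1)) ?_
    have hi : Computable fun x : ((ℕ × ℕ) × Code × (ℕ × ℕ × ℕ)) × ℕ × ℕ => x.1.1.1 :=
      Computable.fst.comp (Computable.fst.comp Computable.fst)
    have hs : Computable fun x : ((ℕ × ℕ) × Code × (ℕ × ℕ × ℕ)) × ℕ × ℕ => x.1.1.2 :=
      Computable.snd.comp (Computable.fst.comp Computable.fst)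
    have hc : Computable fun x : ((ℕ × ℕ) × Code × (ℕ × ℕ × ℕ)) × ℕ × ℕ => x.1.2.1 :=
      Computable.fst.comp (Computable.snd.comp Computable.fst)
    have hy : Computable fun x : ((ℕ × ℕ) × Code × (ℕ × ℕ × ℕ)) × ℕ × ℕ => x.1.2.2 :=
      Computable.snd.comp (Computable.snd.comp Computable.fst)
    have hm := Computable.fst.comp hy
    have hn := Computable.fst.comp (Computable.snd.comp hy)
    have hz := Computable.snd.comp (Computable.snd.comp hy)
    have hu : Computable fun x : ((ℕ × ℕ) × Code × (ℕ × ℕ × ℕ)) × ℕ × ℕ => x.2.1 :=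
      Computable.fst.comp Computable.snd
    have hv : Computable fun x : ((ℕ × ℕ) × Code × (ℕ × ℕ × ℕ)) × ℕ × ℕ => x.2.2 :=
      Computable.snd.comp Computable.snd
    have hnot {g : ((ℕ × ℕ) × Code × (ℕ × ℕ × ℕ)) × ℕ × ℕ → Bool} (hg : Computable g) :
        REPred fun x => ¬ g x = true :=
      (ComputablePred.computable_iff.2 ⟨g, hg, rfl⟩).not.to_re
    have h₁ := rePred_mem_eval.comp (hc.pair (hm.pair hu))
    have h₂ := rePred_mem_eval.comp (hc.pair (hn.pair hv))
    have h₃ := hnot (hR.comp ((hi.pair (hm.pair hn)).pair hz))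
    have h₄ := hF.comp (hs.pair (hu.pair hv))
    have h₅ := hnot (hR'.comp ((hs.pair (hu.pair hv)).pair hz))
    have h₆ := hE.comp (hi.pair (hm.pair hn))
    exact (h₁.and h₂).and ((h₃.or h₄).and (h₅.or h₆))
  refine ⟨fun x => T (x.1, x.2.1, ofNat (ℕ × ℕ × ℕ) x.2.2), hT.comp (Computable.fst.pair
    ((Computable.fst.comp Computable.snd).pair
      ((Computable.ofNat _).comp (Computable.snd.comp Computable.snd)))), fun i s => ?_⟩
  constructor
  · rintro ⟨Φ, hΦ, h⟩
    obtain ⟨c, hc⟩ := Code.exists_code.1 (Partrec.nat_iff.1 hΦ)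
    refine ⟨c, fun y => ⟨(Φ (ofNat (ℕ × ℕ × ℕ) y).1, Φ (ofNat (ℕ × ℕ × ℕ) y).2.1), ?_, ?_, ?_⟩⟩
    · simp [hc]
    · rw [← h, hRE, or_iff_not_imp_left, not_not]
      exact fun h => ⟨_, h⟩
    · rw [h, hRF, or_iff_not_imp_left, not_not]
      exact fun h => ⟨_, h⟩
  · rintro ⟨c, hc⟩
    have key (m n z : ℕ) : T ((i, s), c, m, n, z) := by
      simpa using hc (encode (m, n, z))
    choose Φ hΦ using fun m => let ⟨w, h, _⟩ := key m m 0; Exists.intro w.1 h.1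
    refine ⟨Φ, Partrec.of_eq_tot (Partrec.nat_iff.2 (Code.exists_code.2 ⟨c, rfl⟩)) hΦ,
      fun m n => ?_⟩
    have key' (z : ℕ) : (R ((i, m, n), z) = true → F s (Φ m) (Φ n)) ∧
        (R' ((s, Φ m, Φ n), z) = true → E i m n) := by
      obtain ⟨⟨u, v⟩, ⟨hu, hv⟩, h₁, h₂⟩ := key m n z
      obtain rfl := Part.mem_unique hu (hΦ m)
      obtain rfl := Part.mem_unique hv (hΦ n)
      exact ⟨fun h => h₁.resolve_left (not_not.2 h), fun h => h₂.resolve_left (not_not.2 h)⟩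
    rw [hRE, hRF]
    refine ⟨fun ⟨z, hz⟩ => (hRF _ _ _).1 ((key' z).1 hz),
      fun ⟨z, hz⟩ => (hRE _ _ _).1 ((key' z).2 hz)⟩

theorem isSigma03_exists_ceerEquiv {F : ℕ → ℕ → ℕ → Prop}
    (hF : REPred fun x : ℕ × ℕ × ℕ => F x.1 x.2.1 x.2.2) :
    IsSigma03 {i | ∃ s, CeerEquiv (ceer i) (F s)} := by
  obtain ⟨T, hT, hTred⟩ := exists_rePred_computableReduction rePred_ceer hF
  obtain ⟨T', hT', hTred'⟩ := exists_rePred_computableReduction hF rePred_ceer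
  have hc : Computable fun x : ℕ × (ℕ × Code × Code) × ℕ => x.2.1 :=
    Computable.fst.comp Computable.snd
  have hy : Computable fun x : ℕ × (ℕ × Code × Code) × ℕ => x.2.2 :=
    Computable.snd.comp Computable.snd
  refine isSigma03_of_rePred (β := ℕ × Code × Code)
    ((hT.comp (f := fun x : ℕ × (ℕ × Code × Code) × ℕ => ((x.1, x.2.1.1), x.2.1.2.1, x.2.2))
      ?_).and (hT'.comp (f := fun x : ℕ × (ℕ × Code × Code) × ℕ =>
        ((x.2.1.1, x.1), x.2.1.2.2, x.2.2)) ?_)) fun i => ?_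
  · exact (Computable.fst.pair (Computable.fst.comp hc)).pair
      ((Computable.fst.comp (Computable.snd.comp hc)).pair hy)
  · exact ((Computable.fst.comp hc).pair Computable.fst).pair
      ((Computable.snd.comp (Computable.snd.comp hc)).pair hy)
  · simp only [Set.mem_ofPred_eq, CeerEquiv, hTred, hTred', Prod.exists, forall_and]
    exact exists_congr fun s => ⟨fun ⟨⟨a, ha⟩, b, hb⟩ => ⟨a, b, ha, hb⟩,
      fun ⟨a, b, ha, hb⟩ => ⟨⟨a, ha⟩, b, hb⟩⟩

theorem FreeGroup.toWord_map_of_injective {α β : Type} [DecidableEq α] [DecidableEq β] {f : α → β}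
    (hf : Function.Injective f) (g : FreeGroup α) :
    (FreeGroup.map f g).toWord = g.toWord.map fun p => (f p.1, p.2) := by
  have h : FreeGroup.IsReduced (g.toWord.map fun p => (f p.1, p.2)) := by
    rw [FreeGroup.IsReduced, List.isChain_map]
    exact FreeGroup.isReduced_toWord.imp fun a b h e => h (hf e)
  rw [← h.reduce_eq, ← FreeGroup.toWord_mk, ← FreeGroup.map.mk, FreeGroup.mk_toWord]

/-- The word coded by `m`, empty if `m` is not a code. -/
def codedWord (m : ℕ) : List (ℕ × Bool) := (decode (α := List (ℕ × Bool)) m).getD []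

theorem codedWord_encode (l : List (ℕ × Bool)) : codedWord (encode l) = l := by
  simp [codedWord]

theorem primrec_codedWord : Primrec codedWord :=
  Primrec.option_getD.comp Primrec.decode (Primrec.const [])

/-- The word over all of `ℕ` coded by `m`, as an element of the free group on `ℕ`. -/
def decodeWord (m : ℕ) : FreeGroup ℕ := FreeGroup.mk (codedWord m)

/-- Equality of coded words in the group presented by `⟨ℕ ∣ R⟩`. -/
def natWordProblem (R : Set (FreeGroup ℕ)) (m n : ℕ) : Prop :=
  PresentedGroup.mk R (decodeWord m) = PresentedGroup.mk R (decodeWord n)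

/-- The relators over the generators `ℕ` given by the `e`-th c.e. set. -/
def natRelSet (e : ℕ) : Set (FreeGroup ℕ) := {g | encode g.toWord ∈ W e}

/-- Relators over `ℕ` presenting the same group as `⟨X ∣ relSetX X e⟩`, by trivialising the
generators outside `X`. -/
def extendedRelSet (X : Set ℕ) (e : ℕ) : Set (FreeGroup ℕ) :=
  {g | ((∀ p ∈ g.toWord, p.1 ∈ X) ∧ encode g.toWord ∈ W e) ∨ ∃ n ∉ X, g = FreeGroup.of n}

/-- Delete the letters outside `X` from a word. -/
noncomputable def dropLetters (X : Set ℕ) (l : List (ℕ × Bool)) : List (X × Bool) :=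
  l.filterMap fun p =>
    @dite _ (p.1 ∈ X) (Classical.dec _) (fun h => some ((⟨p.1, h⟩ : X), p.2)) fun _ => none

theorem decodeWordX_eq (X : Set ℕ) (m : ℕ) :
    decodeWordX X m = FreeGroup.mk (dropLetters X (codedWord m)) := rfl

theorem dropLetters_cons_of_mem {X : Set ℕ} {p : ℕ × Bool} (h : p.1 ∈ X) (l : List (ℕ × Bool)) :
    dropLetters X (p :: l) = (⟨p.1, h⟩, p.2) :: dropLetters X l := by
  simp [dropLetters, h]

theorem dropLetters_cons_of_notMem {X : Set ℕ} {p : ℕ × Bool} (h : p.1 ∉ X)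
    (l : List (ℕ × Bool)) : dropLetters X (p :: l) = dropLetters X l := by
  simp [dropLetters, h]

theorem map_val_dropLetters {X : Set ℕ} {l : List (ℕ × Bool)} (h : ∀ p ∈ l, p.1 ∈ X) :
    (dropLetters X l).map (fun p => ((p.1 : ℕ), p.2)) = l := by
  induction l with
  | nil => rfl
  | cons p l ih =>
    rw [dropLetters_cons_of_mem (h p (by simp))]
    simp [ih fun q hq => h q (by simp [hq])]

theorem encodeFGX_eq {X : Set ℕ} (g : FreeGroup X) :
    encodeFGX g = encode (FreeGroup.map Subtype.val g).toWord := by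
  rw [FreeGroup.toWord_map_of_injective Subtype.val_injective]
  rfl

/-- The map of presented groups induced by the inclusion of the generators. -/
def toExtended (X : Set ℕ) (e : ℕ) :
    PresentedGroup (relSetX X e) →* PresentedGroup (extendedRelSet X e) :=
  PresentedGroup.map (FreeGroup.map Subtype.val) fun g hg => by
    refine Or.inl ⟨fun p hp => ?_, ?_⟩
    · rw [FreeGroup.toWord_map_of_injective Subtype.val_injective] at hp
      obtain ⟨q, -, rfl⟩ := List.mem_map.1 hp
      exact q.1.2
    · rw [← encodeFGX_eq]
      exact hg

/-- The image of a generator under deletion of the generators outside `X`. -/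
noncomputable def restrictGenerator (X : Set ℕ) (e n : ℕ) : PresentedGroup (relSetX X e) :=
  @dite _ (n ∈ X) (Classical.dec _) (fun h => PresentedGroup.of ⟨n, h⟩) fun _ => 1

theorem lift_restrictGenerator (X : Set ℕ) (e : ℕ) (l : List (ℕ × Bool)) :
    FreeGroup.lift (restrictGenerator X e) (FreeGroup.mk l) =
      PresentedGroup.mk (relSetX X e) (FreeGroup.mk (dropLetters X l)) := by
  induction l with
  | nil => simp [dropLetters, ← FreeGroup.one_eq_mk]
  | cons p l ih =>
    rw [FreeGroup.lift_mk] at ih ⊢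
    rw [List.map_cons, List.prod_cons, ih]
    by_cases h : p.1 ∈ X
    · rw [dropLetters_cons_of_mem h, ← List.singleton_append, ← FreeGroup.mul_mk, map_mul]
      congr 1
      obtain ⟨n, b⟩ := p
      cases b
      · simp only [restrictGenerator, h, dite_true, cond_false, PresentedGroup.of]
        rw [← map_inv]
        rfl
      · simp only [restrictGenerator, h, dite_true, cond_true, PresentedGroup.of]
        rfl
    · rw [dropLetters_cons_of_notMem h]
      simp [restrictGenerator, h]

/-- The map of presented groups deleting the generators outside `X`. -/
noncomputable def ofExtended (X : Set ℕ) (e : ℕ) :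
    PresentedGroup (extendedRelSet X e) →* PresentedGroup (relSetX X e) :=
  PresentedGroup.toGroup (f := restrictGenerator X e) fun g hg => by
    rcases hg with ⟨hX, he⟩ | ⟨n, hn, rfl⟩
    · rw [← FreeGroup.mk_toWord (x := g), lift_restrictGenerator]
      refine PresentedGroup.one_of_mem ?_
      change encodeFGX _ ∈ W e
      rwa [encodeFGX_eq, FreeGroup.map.mk, map_val_dropLetters hX, FreeGroup.mk_toWord]
    · simp [restrictGenerator, hn]

theorem toExtended_mk (X : Set ℕ) (e : ℕ) (l : List (ℕ × Bool)) :
    toExtended X e (PresentedGroup.mk _ (FreeGroup.mk (dropLetters X l))) =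
      PresentedGroup.mk _ (FreeGroup.mk l) := by
  change PresentedGroup.mk _ (FreeGroup.map Subtype.val (FreeGroup.mk (dropLetters X l))) = _
  rw [FreeGroup.map.mk]
  induction l with
  | nil => rfl
  | cons p l ih =>
    rw [← List.singleton_append (l := l), ← FreeGroup.mul_mk, map_mul, ← ih]
    by_cases h : p.1 ∈ X
    · rw [← map_mul, FreeGroup.mul_mk, List.singleton_append, List.singleton_append,
        dropLetters_cons_of_mem h, List.map_cons]
    · rw [List.singleton_append, dropLetters_cons_of_notMem h, eq_comm, mul_eq_right]
      have hof : PresentedGroup.mk (extendedRelSet X e) (FreeGroup.of p.1) = 1 :=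
        PresentedGroup.one_of_mem (Or.inr ⟨_, h, rfl⟩)
      obtain ⟨n, b⟩ := p
      cases b
      · rw [← inv_eq_one, ← map_inv, FreeGroup.inv_mk]
        exact hof
      · exact hof

theorem wordProblemX_eq (X : Set ℕ) (e : ℕ) :
    wordProblemX X e = natWordProblem (extendedRelSet X e) := by
  funext m n
  simp only [wordProblemX, natWordProblem, decodeWordX_eq, decodeWord]
  refine propext ⟨fun h => ?_, fun h => ?_⟩
  · rw [← toExtended_mk, h, toExtended_mk]
  · have hof (l : List (ℕ × Bool)) : ofExtended X e (PresentedGroup.mk _ (FreeGroup.mk l)) =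
        PresentedGroup.mk _ (FreeGroup.mk (dropLetters X l)) := lift_restrictGenerator X e l
    rw [← hof, h, hof]

theorem extendedRelSet_univ (e : ℕ) : extendedRelSet Set.univ e = natRelSet e := by
  ext g
  simp [extendedRelSet, natRelSet]

theorem exists_natRelSet_eq {X : Set ℕ} (hX : ComputablePred (· ∈ X)) (e : ℕ) :
    ∃ s, extendedRelSet X e = natRelSet s := by
  have hmem : REPred fun x : ℕ × ℕ => x.2 < (codedWord x.1).length →
      ((codedWord x.1).getD x.2 (0, true)).1 ∈ X := by
    obtain ⟨f, hf, hfX⟩ := ComputablePred.computable_iff.1 hX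
    have hlen : ComputablePred fun x : ℕ × ℕ => x.2 < (codedWord x.1).length :=
      (Primrec.nat_lt.comp Primrec.snd
        (Primrec.list_length.comp (primrec_codedWord.comp Primrec.fst))).computablePred
    have hget : REPred fun x : ℕ × ℕ =>
        ((codedWord x.1).getD x.2 (0, true)).1 ∈ X :=
      REPred.comp hX.to_re (f := fun x : ℕ × ℕ =>
        ((codedWord x.1).getD x.2 (0, true)).1)
        (Primrec.fst.comp ((Primrec.list_getD _).comp (primrec_codedWord.comp Primrec.fst)
          Primrec.snd)).to_comp
    exact (hlen.not.to_re.or hget).of_eq fun x => imp_iff_not_or.symm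
  have hall : REPred fun c => ∀ p ∈ codedWord c, p.1 ∈ X := by
    have h := REPred.comp (REPred.forall_lt (p := fun c i =>
      i < (codedWord c).length →
        ((codedWord c).getD i (0, true)).1 ∈ X) hmem)
      (f := fun c => (c, (codedWord c).length))
      (Computable.id.pair (Computable.list_length.comp primrec_codedWord.to_comp))
    refine h.of_eq fun c => ?_
    rw [List.forall_mem_iff_getElem]
    refine forall_congr' fun i => ⟨fun h hi => ?_, fun h hi _ => ?_⟩
    · exact List.getD_eq_getElem _ (0, true) hi ▸ h hi hi
    · exact (List.getD_eq_getElem _ (0, true) hi).symm ▸ h hi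
  have hgen : REPred fun c => ∃ n : ℕ, n ∉ X ∧ c = encode [(n, true)] := by
    refine REPred.exists (p := fun c n => n ∉ X ∧ c = encode [(n, true)])
      (REPred.and (REPred.comp hX.not.to_re Computable.snd) ?_)
    refine (PrimrecPred.computablePred (Primrec.eq.comp Primrec.fst
      (Primrec.encode.comp (Primrec.list_cons.comp ?_ (Primrec.const []))))).to_re
    exact Primrec.snd.pair (Primrec.const _)
  obtain ⟨s, hs⟩ := exists_index_of_rePred
    ((hall.and (REPred.comp rePred_mem_W ((Computable.const e).pair Computable.id))).or hgen)
  refine ⟨s, Set.ext fun g => ?_⟩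
  simp only [natRelSet, Set.mem_ofPred_eq, hs, codedWord_encode, extendedRelSet]
  refine or_congr Iff.rfl (exists_congr fun n => and_congr Iff.rfl ?_)
  rw [encode_inj, ← FreeGroup.toWord_of, FreeGroup.toWord_inj]

theorem rpWordProblemIndices_eq :
    RPWordProblemIndices = {i | ∃ s, CeerEquiv (ceer i) (natWordProblem (natRelSet s))} := by
  ext i
  simp only [RPWordProblemIndices, wordProblemX_eq, Set.mem_ofPred_eq]
  constructor
  · rintro ⟨X, hX, e, h⟩
    obtain ⟨s, hs⟩ := exists_natRelSet_eq hX e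
    exact ⟨s, hs ▸ h⟩
  · rintro ⟨s, h⟩
    refine ⟨Set.univ, (ComputablePred.computable_iff.2 ⟨_, Computable.const true, ?_⟩), s, ?_⟩
    · simp
    · rwa [extendedRelSet_univ]

theorem FreeGroup.primrec_reduce {α : Type} [Primcodable α] [DecidableEq α] :
    Primrec (FreeGroup.reduce : List (α × Bool) → List (α × Bool)) := by
  have hstep : Primrec₂ fun (_ : List (α × Bool))
      (x : (α × Bool) × List (α × Bool) × List (α × Bool)) =>
      (List.casesOn x.2.2 [x.1] fun hd tl =>
        if x.1.1 = hd.1 ∧ x.1.2 = !hd.2 then tl else x.1 :: hd :: tl : List (α × Bool)) := by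
    have hx : Primrec fun x : List (α × Bool) × (α × Bool) × List (α × Bool) × List (α × Bool) =>
        x.2.1 := Primrec.fst.comp Primrec.snd
    have hite : Primrec fun x : (List (α × Bool) × (α × Bool) × List (α × Bool) ×
        List (α × Bool)) × (α × Bool) × List (α × Bool) =>
        if x.1.2.1.1 = x.2.1.1 ∧ x.1.2.1.2 = !x.2.1.2 then x.2.2
          else x.1.2.1 :: x.2.1 :: x.2.2 := by
      refine Primrec.ite (PrimrecPred.and ?_ ?_) ?_ ?_
      · exact Primrec.eq.comp (Primrec.fst.comp (hx.comp Primrec.fst))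
          (Primrec.fst.comp (Primrec.fst.comp Primrec.snd))
      · exact Primrec.eq.comp (Primrec.snd.comp (hx.comp Primrec.fst))
          (Primrec.not.comp (Primrec.snd.comp (Primrec.fst.comp Primrec.snd)))
      · exact Primrec.snd.comp Primrec.snd
      · exact Primrec.list_cons.comp (hx.comp Primrec.fst)
          (Primrec.list_cons.comp (Primrec.fst.comp Primrec.snd) (Primrec.snd.comp Primrec.snd))
    exact Primrec.list_casesOn (Primrec.snd.comp (Primrec.snd.comp Primrec.snd))
      (Primrec.list_cons.comp hx (Primrec.const [])) hite.to₂
  exact (Primrec.list_rec Primrec.id (Primrec.const []) hstep).of_eq fun l => rfl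

theorem FreeGroup.primrec_invRev {α : Type} [Primcodable α] :
    Primrec (FreeGroup.invRev : List (α × Bool) → List (α × Bool)) :=
  Primrec.list_reverse.comp (Primrec.list_map Primrec.id
    (Primrec.pair (Primrec.fst.comp Primrec.snd)
      (Primrec.not.comp (Primrec.snd.comp Primrec.snd))).to₂)

/-- `n` codes the same group element as `m`, or `m` multiplied by a conjugate of a relator. -/
def relatorStep (R : Set (FreeGroup ℕ)) (m n : ℕ) : Prop :=
  decodeWord n = decodeWord m ∨
    ∃ g, ∃ r ∈ R, decodeWord n = decodeWord m * (g * r * g⁻¹)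

theorem decodeWord_encode (l : List (ℕ × Bool)) :
    decodeWord (encode l) = FreeGroup.mk l := by
  rw [decodeWord, codedWord_encode]

theorem decodeWord_surjective : Function.Surjective decodeWord := fun g =>
  ⟨encode g.toWord, by rw [decodeWord_encode, FreeGroup.mk_toWord]⟩

theorem natWordProblem_iff_eqvGen (R : Set (FreeGroup ℕ)) (m n : ℕ) :
    natWordProblem R m n ↔ Relation.EqvGen (relatorStep R) m n := by
  constructor
  · intro h
    have hmem : (decodeWord m)⁻¹ * decodeWord n ∈ Subgroup.closure (Group.conjugatesOfSet R) := by
      change _ ∈ Subgroup.normalClosure R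
      rw [← PresentedGroup.mk_eq_one_iff, map_mul, map_inv, inv_mul_eq_one]
      exact h
    have key : ∀ x ∈ Subgroup.closure (Group.conjugatesOfSet R), ∀ m n,
        decodeWord n = decodeWord m * x → Relation.EqvGen (relatorStep R) m n := by
      intro x hx
      induction hx using Subgroup.closure_induction with
      | mem x hx =>
        obtain ⟨r, hr, hx⟩ := Group.mem_conjugatesOfSet_iff.1 hx
        obtain ⟨g, rfl⟩ := isConj_iff.1 hx
        exact fun m n h => .rel _ _ (.inr ⟨g, r, hr, h⟩)
      | one => exact fun m n h => .rel _ _ (.inl (by simpa using h))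
      | mul x y _ _ hx hy =>
        intro m n h
        obtain ⟨k, hk⟩ := decodeWord_surjective (decodeWord m * x)
        exact (hx m k hk).trans _ _ _ (hy k n (by rw [h, hk, mul_assoc]))
      | inv x _ hx => exact fun m n h => (hx n m (by rw [h, inv_mul_cancel_right])).symm
    exact key _ hmem m n (mul_inv_cancel_left _ _).symm
  · intro h
    induction h with
    | rel m n h =>
      rcases h with h | ⟨g, r, hr, h⟩
      · simp [natWordProblem, h]
      · simp [natWordProblem, h, PresentedGroup.one_of_mem hr]
    | refl => rfl
    | symm _ _ _ ih => exact Eq.symm ih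
    | trans _ _ _ _ _ h₁ h₂ => exact Eq.trans h₁ h₂

theorem rePred_relatorStep :
    REPred fun x : ℕ × ℕ × ℕ => relatorStep (natRelSet x.1) x.2.1 x.2.2 := by
  have hw : Primrec fun m => FreeGroup.reduce (codedWord m) :=
    FreeGroup.primrec_reduce.comp primrec_codedWord
  have heq : REPred fun x : ℕ × ℕ × ℕ => FreeGroup.reduce (codedWord x.2.2) =
      FreeGroup.reduce (codedWord x.2.1) :=
    (Primrec.eq.comp (hw.comp (Primrec.snd.comp Primrec.snd))
      (hw.comp (Primrec.fst.comp Primrec.snd))).computablePred.to_re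
  have hconj : REPred fun x : ℕ × ℕ × ℕ => ∃ b : List (ℕ × Bool) × List (ℕ × Bool),
      encode b.2 ∈ W x.1 ∧ FreeGroup.reduce b.2 = b.2 ∧
        FreeGroup.reduce (codedWord x.2.2) = FreeGroup.reduce
          (codedWord x.2.1 ++ (b.1 ++ b.2 ++ FreeGroup.invRev b.1)) := by
    have hg : Primrec fun x : (ℕ × ℕ × ℕ) × List (ℕ × Bool) × List (ℕ × Bool) => x.2.1 :=
      Primrec.fst.comp Primrec.snd
    have hr : Primrec fun x : (ℕ × ℕ × ℕ) × List (ℕ × Bool) × List (ℕ × Bool) => x.2.2 :=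
      Primrec.snd.comp Primrec.snd
    refine REPred.exists (p := fun (x : ℕ × ℕ × ℕ) (b : List (ℕ × Bool) × List (ℕ × Bool)) =>
      encode b.2 ∈ W x.1 ∧ FreeGroup.reduce b.2 = b.2 ∧
        FreeGroup.reduce (codedWord x.2.2) = FreeGroup.reduce
          (codedWord x.2.1 ++ (b.1 ++ b.2 ++ FreeGroup.invRev b.1)))
      (REPred.and ?_ (REPred.and ?_ ?_))
    · exact REPred.comp rePred_mem_W (f := fun x : (ℕ × ℕ × ℕ) × List (ℕ × Bool) ×
        List (ℕ × Bool) => (x.1.1, encode x.2.2))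
        ((Primrec.fst.comp Primrec.fst).pair (Primrec.encode.comp hr)).to_comp
    · exact (Primrec.eq.comp (FreeGroup.primrec_reduce.comp hr) hr).computablePred.to_re
    · exact (Primrec.eq.comp (hw.comp (Primrec.snd.comp (Primrec.snd.comp Primrec.fst)))
        (FreeGroup.primrec_reduce.comp (Primrec.list_append.comp
          (primrec_codedWord.comp (Primrec.fst.comp (Primrec.snd.comp Primrec.fst)))
          (Primrec.list_append.comp (Primrec.list_append.comp hg hr)
            (FreeGroup.primrec_invRev.comp hg))))).computablePred.to_re
  refine (heq.or hconj).of_eq fun ⟨s, m, n⟩ => ?_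
  have hmk (l l' : List (ℕ × Bool)) :
      FreeGroup.reduce l = FreeGroup.reduce l' ↔ FreeGroup.mk l = FreeGroup.mk l' :=
    ⟨FreeGroup.reduce.exact, FreeGroup.reduce.sound⟩
  refine or_congr (hmk _ _) ⟨?_, ?_⟩
  · rintro ⟨⟨g, r⟩, hr, hred, h⟩
    refine ⟨FreeGroup.mk g, FreeGroup.mk r, ?_, ?_⟩
    · change encode (FreeGroup.mk r).toWord ∈ W s
      rwa [FreeGroup.toWord_mk, hred]
    · simpa only [decodeWord, FreeGroup.mul_mk, FreeGroup.inv_mk] using (hmk _ _).1 h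
  · rintro ⟨g, r, hr, h⟩
    refine ⟨(g.toWord, r.toWord), hr, FreeGroup.reduce_toWord r, (hmk _ _).2 ?_⟩
    simp only [← FreeGroup.mul_mk, ← FreeGroup.inv_mk, FreeGroup.mk_toWord]
    exact h

theorem rePred_natWordProblem :
    REPred fun x : ℕ × ℕ × ℕ => natWordProblem (natRelSet x.1) x.2.1 x.2.2 :=
  (rePred_eqvGen (r := fun s => relatorStep (natRelSet s)) rePred_relatorStep).of_eq
    fun _ => (natWordProblem_iff_eqvGen _ _ _).symm

theorem isSigma03_rpWordProblemIndices : IsSigma03 RPWordProblemIndices :=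
  rpWordProblemIndices_eq ▸ isSigma03_exists_ceerEquiv rePred_natWordProblem

theorem ComputablePred.comp {α β : Type} [Primcodable α] [Primcodable β] {p : β → Prop}
    (hp : ComputablePred p) {f : α → β} (hf : Computable f) : ComputablePred fun a => p (f a) := by
  obtain ⟨g, hg, rfl⟩ := ComputablePred.computable_iff.1 hp
  exact ComputablePred.computable_iff.2 ⟨_, hg.comp hf, rfl⟩

/-- The equivalence relation whose only possibly nontrivial class is `V`. -/
def collapse (V : Set ℕ) (m n : ℕ) : Prop := m = n ∨ (m ∈ V ∧ n ∈ V)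

theorem ceer_eq_collapse {i : ℕ} {V : Set ℕ}
    (h : ∀ k, k ∈ W i ↔ k.unpair.1 ∈ V ∧ k.unpair.2 ∈ V) : ceer i = collapse V := by
  funext m n
  refine propext ⟨fun hmn => ?_, ?_⟩
  · induction hmn with
    | rel m n hmn => exact .inr (by simpa [h] using hmn)
    | refl => exact .inl rfl
    | symm m n _ ih => exact ih.imp Eq.symm And.symm
    | trans _ _ _ _ _ h₁ h₂ =>
      rcases h₁ with rfl | h₁
      · exact h₂
      · rcases h₂ with rfl | h₂
        · exact .inr h₁
        · exact .inr ⟨h₁.1, h₂.2⟩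
  · rintro (rfl | hmn)
    · exact .refl _
    · exact .rel _ _ ((h _).2 (by simpa using hmn))

theorem computablePred_of_collapse_ceerEquiv {V : Set ℕ} {R : Set (FreeGroup ℕ)}
    (h : CeerEquiv (collapse V) (natWordProblem R)) : ComputablePred (· ∈ V) := by
  obtain ⟨⟨Ψ, hΨ, hΨV⟩, ⟨Φ, hΦ, hΦV⟩⟩ := h
  rcases V.eq_empty_or_nonempty with rfl | ⟨v, hv⟩
  · exact ComputablePred.computable_iff.2 ⟨_, Computable.const false, by simp⟩
  have hmem (a : ℕ) : a ∈ V ↔ collapse V v a :=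
    ⟨fun ha => .inr ⟨hv, ha⟩, by rintro (rfl | ha); exacts [hv, ha.2]⟩
  by_cases hx : ∃ x, Φ x ∉ V
  · obtain ⟨x, hx⟩ := hx
    let t (a : ℕ) : ℕ :=
      encode (codedWord x ++ (FreeGroup.invRev (codedWord (Ψ v)) ++ codedWord (Ψ a)))
    have ht : Computable t := by
      refine Computable.encode.comp (Computable.list_append.comp (Computable.const _)
        (Computable.list_append.comp (Computable.const _) (primrec_codedWord.to_comp.comp hΨ)))
    have hVt (a : ℕ) : a ∈ V ↔ Φ x = Φ (t a) := by
      rw [hmem, hΨV]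
      trans natWordProblem R x (t a)
      · simp only [natWordProblem, t, decodeWord_encode]
        rw [← FreeGroup.mul_mk, ← FreeGroup.mul_mk, ← FreeGroup.inv_mk, map_mul, map_mul, map_inv]
        exact inv_mul_eq_one.symm.trans mul_eq_left.symm |>.trans eq_comm
      · rw [hΦV]
        exact or_iff_left fun h => hx h.1
    have heq : ComputablePred fun p : ℕ × ℕ => p.1 = p.2 :=
      (Primrec.eq.comp Primrec.fst Primrec.snd).computablePred
    exact (heq.comp ((Computable.const (Φ x)).pair (hΦ.comp ht))).of_eq fun a => (hVt a).symm
  · push Not at hx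
    refine (ComputablePred.computable_iff.2 ⟨_, Computable.const true, rfl⟩).of_eq fun a => ?_
    have ha : a ∈ V := (hmem a).2 ((hΨV v a).2 ((hΦV _ _).2 (.inr ⟨hx _, hx _⟩)))
    simp [ha]

theorem exists_collapse_ceerEquiv {V : Set ℕ} (hV : ComputablePred (· ∈ V))
    (hodd : ∀ k, 2 * k + 1 ∉ V) :
    ∃ s, CeerEquiv (collapse V) (natWordProblem (natRelSet s)) := by
  obtain ⟨s, hs⟩ := exists_index_of_rePred (p := fun _ => False)
    (ComputablePred.computable_iff.2 ⟨_, Computable.const false, by simp⟩).to_re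
  have hrel : natRelSet s = ∅ := by
    ext g
    simp [natRelSet, hs]
  have hwp (m n : ℕ) : natWordProblem (natRelSet s) m n ↔
      FreeGroup.reduce (codedWord m) = FreeGroup.reduce (codedWord n) := by
    rw [natWordProblem, ← inv_mul_eq_one, ← map_inv, ← map_mul, PresentedGroup.mk_eq_one_iff, hrel,
      Subgroup.normalClosure_eq_bot_iff.2 (Set.empty_subset _), Subgroup.mem_bot, inv_mul_eq_one]
    exact ⟨FreeGroup.reduce.sound, FreeGroup.reduce.exact⟩
  obtain ⟨f, hf, hfV⟩ := ComputablePred.computable_iff.1 hV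
  replace hfV (a : ℕ) : a ∈ V ↔ f a = true := iff_of_eq (congrFun hfV a)
  refine ⟨s, ⟨fun k => encode [(cond (f k) 0 (k + 1), true)], ?_, fun m n => ?_⟩,
    ⟨fun m => 2 * encode (FreeGroup.reduce (codedWord m)) + 1, ?_, fun m n => ?_⟩⟩
  · exact Computable.encode.comp (Computable.list_cons.comp
      ((Computable.cond hf (Computable.const 0) Computable.succ).pair (Computable.const true))
      (Computable.const []))
  · rw [hwp, codedWord_encode, codedWord_encode, FreeGroup.reduce_singleton,
      FreeGroup.reduce_singleton, collapse, hfV, hfV]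
    cases hm : f m <;> cases hn : f n <;> simp
    · rintro rfl
      simp [hm] at hn
    · rintro rfl
      simp [hm] at hn
  · exact (Primrec.succ.comp (Primrec.nat_mul.comp (Primrec.const 2) (Primrec.encode.comp
      (FreeGroup.primrec_reduce.comp primrec_codedWord)))).to_comp
  · rw [hwp, collapse, or_iff_left fun h => hodd _ h.1]
    simp

theorem computablePred_of_initial_columns {P : ℕ → ℕ → Prop} (hP : ∀ x z, P x (z + 1) → P x z)
    {k : ℕ} (hk : ∀ x ≥ k, ∀ z, P x z) : ComputablePred fun q : ℕ × ℕ => P q.1 q.2 := by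
  induction k generalizing P with
  | zero =>
    exact (ComputablePred.computable_iff.2 ⟨_, Computable.const true, rfl⟩).of_eq fun q => by
      simpa using hk q.1 (Nat.zero_le _) q.2
  | succ k ih =>
    have hcol : ComputablePred (P k) := by
      by_cases h : ∀ z, P k z
      · exact (ComputablePred.computable_iff.2 ⟨_, Computable.const true, rfl⟩).of_eq fun z => by
          simpa using h z
      · classical
        push Not at h
        have hanti : Antitone (P k) := antitone_nat_of_succ_le (hP k)
        refine (Primrec.nat_lt.comp Primrec.id
          (Primrec.const (Nat.find h))).computablePred.of_eq fun z => ?_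
        exact ⟨fun hz => not_not.1 (Nat.find_min h hz),
          fun hz => lt_of_not_ge fun hle => Nat.find_spec h (hanti hle hz)⟩
    have hrest := ih (P := fun x z => x = k ∨ P x z) (fun x z => Or.imp_right (hP x z))
      fun x hx z => hx.eq_or_lt.imp Eq.symm fun hlt => hk x hlt z
    obtain ⟨f, hf, hfP⟩ := ComputablePred.computable_iff.1 hcol
    obtain ⟨g, hg, hgP⟩ := ComputablePred.computable_iff.1 hrest
    refine ComputablePred.computable_iff.2 ⟨fun q => cond (decide (q.1 = k)) (f q.2) (g q),
      Computable.cond ?_ (hf.comp Computable.snd) hg, funext fun q => ?_⟩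
    · exact (Primrec.eq.comp Primrec.fst (Primrec.const k)).decide.to_comp
    · have hfq := congrFun hfP q.2
      have hgq := congrFun hgP q
      by_cases hq : q.1 = k
      · simpa [hq] using hfq
      · simpa [hq] using hgq

/-- The halting problem on input `0`, as a predicate on codes of programs. -/
def Halts (x : ℕ) : Prop := ((ofNat Code x).eval 0).Dom

theorem rePred_halts : REPred Halts :=
  (ComputablePred.halting_problem_re 0).comp (Computable.ofNat Code)

theorem not_rePred_not_halts : ¬ REPred fun x => ¬ Halts x := fun h =>
  ComputablePred.halting_problem_not_re 0
    ((h.comp Computable.encode).of_eq fun c => by simp [Halts])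

section Hardness

variable (R : ℕ → ℕ → ℕ → ℕ → Bool)

/-- Some existential witness `≤ x` passes its first `z` tests. -/
def PassesTests (n x z : ℕ) : Prop := ∃ x' ≤ x, ∀ y < z, ∃ w, R n x' y w = true

/-- The `x`-th column is the initial segment given by `PassesTests`, lengthened by one if `x`
lies in the halting set. -/
def MarkedColumn (n x z : ℕ) : Prop :=
  PassesTests R n x z ∨ (Halts x ∧ PassesTests R n x (z - 1))

/-- The set of even numbers coding the points of the columns. -/
def markedSet (n : ℕ) : Set ℕ :=
  {v | v % 2 = 0 ∧ MarkedColumn R n (v / 2).unpair.1 (v / 2).unpair.2}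

variable {R}

theorem PassesTests.anti {n x z z' : ℕ} (hz : z' ≤ z) (h : PassesTests R n x z) :
    PassesTests R n x z' :=
  let ⟨x', hx', h⟩ := h
  ⟨x', hx', fun y hy => h y (hy.trans_le hz)⟩

theorem MarkedColumn.of_succ {n x z : ℕ} (h : MarkedColumn R n x (z + 1)) :
    MarkedColumn R n x z :=
  .inl (h.elim (fun h => h.anti (Nat.le_succ z)) fun h => h.2)

theorem rePred_passesTests
    (hR : Computable fun p : ℕ × ℕ × ℕ × ℕ => R p.1 p.2.1 p.2.2.1 p.2.2.2) :
    REPred fun p : ℕ × ℕ × ℕ => PassesTests R p.1 p.2.1 p.2.2 := by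
  have hR' : Computable fun p : ((ℕ × ℕ) × ℕ) × ℕ => R p.1.1.1 p.1.1.2 p.1.2 p.2 :=
    Computable.comp (g := fun p : ((ℕ × ℕ) × ℕ) × ℕ => (p.1.1.1, p.1.1.2, p.1.2, p.2)) hR
      ((Computable.fst.comp (Computable.fst.comp Computable.fst)).pair
        ((Computable.snd.comp (Computable.fst.comp Computable.fst)).pair
          ((Computable.snd.comp Computable.fst).pair Computable.snd)))
  have h₁ : REPred fun p : (ℕ × ℕ) × ℕ => ∃ w, R p.1.1 p.1.2 p.2 w = true :=
    rePred_of_exists hR' fun _ => Iff.rfl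
  have h₂ : REPred fun x : (ℕ × ℕ) × ℕ => ∀ y < x.2, ∃ w, R x.1.1 x.1.2 y w = true :=
    REPred.forall_lt (p := fun (q : ℕ × ℕ) y => ∃ w, R q.1 q.2 y w = true) h₁
  have hle : REPred fun p : (ℕ × ℕ × ℕ) × ℕ => p.2 ≤ p.1.2.1 :=
    (Primrec.nat_le.comp Primrec.snd
      (Primrec.fst.comp (Primrec.snd.comp Primrec.fst))).computablePred.to_re
  have htests : REPred fun p : (ℕ × ℕ × ℕ) × ℕ =>
      ∀ y < p.1.2.2, ∃ w, R p.1.1 p.2 y w = true :=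
    REPred.comp h₂ (f := fun p : (ℕ × ℕ × ℕ) × ℕ => ((p.1.1, p.2), p.1.2.2))
      (((Computable.fst.comp Computable.fst).pair Computable.snd).pair
        (Computable.snd.comp (Computable.snd.comp Computable.fst)))
  exact REPred.exists (p := fun (p : ℕ × ℕ × ℕ) x' =>
    x' ≤ p.2.1 ∧ ∀ y < p.2.2, ∃ w, R p.1 x' y w = true) (hle.and htests)

theorem rePred_markedSet
    (hR : Computable fun p : ℕ × ℕ × ℕ × ℕ => R p.1 p.2.1 p.2.2.1 p.2.2.2) :
    REPred fun p : ℕ × ℕ => p.2 ∈ markedSet R p.1 := by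
  have hq : Primrec fun p : ℕ × ℕ => (p.2 / 2).unpair :=
    Primrec.unpair.comp (Primrec.nat_div2.comp Primrec.snd |>.of_eq fun p => Nat.div2_val _)
  have hx : Primrec fun p : ℕ × ℕ => (p.2 / 2).unpair.1 := Primrec.fst.comp hq
  have hz : Primrec fun p : ℕ × ℕ => (p.2 / 2).unpair.2 := Primrec.snd.comp hq
  have hpass := rePred_passesTests hR
  have h₁ : REPred fun p : ℕ × ℕ => p.2 % 2 = 0 :=
    (Primrec.eq.comp (Primrec.nat_mod.comp Primrec.snd (Primrec.const 2))
      (Primrec.const 0)).computablePred.to_re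
  have h₂ := hpass.comp (Primrec.fst.pair (hx.pair hz)).to_comp
  have h₃ := rePred_halts.comp hx.to_comp
  have h₄ := hpass.comp (Primrec.fst.pair (hx.pair (Primrec.pred.comp hz))).to_comp
  exact h₁.and (h₂.or (h₃.and h₄))

theorem computablePred_markedSet {n x : ℕ} (hx : ∀ y, ∃ w, R n x y w = true) :
    ComputablePred (· ∈ markedSet R n) := by
  classical
  have hcol : ComputablePred fun q : ℕ × ℕ => MarkedColumn R n q.1 q.2 :=
    computablePred_of_initial_columns (fun _ _ h => h.of_succ)
      (k := x) fun x' hx' z => .inl ⟨x, hx', fun y _ => hx y⟩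
  obtain ⟨f, hf, hfP⟩ := ComputablePred.computable_iff.1 hcol
  refine ComputablePred.computable_iff.2 ⟨fun v => cond (decide (v % 2 = 0))
    (f (v / 2).unpair) false, Computable.cond ?_ (hf.comp ?_) (Computable.const false),
    funext fun v => ?_⟩
  · exact (Primrec.eq.comp (Primrec.nat_mod.comp Primrec.id (Primrec.const 2))
      (Primrec.const 0)).decide.to_comp
  · exact Computable.unpair.comp (Computable.nat_div2.of_eq Nat.div2_val)
  · have hfv := congrFun hfP (v / 2).unpair
    by_cases hv : v % 2 = 0
    · simpa [markedSet, hv] using hfv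
    · simp [markedSet, hv]

theorem not_computablePred_markedSet
    (hR : Computable fun p : ℕ × ℕ × ℕ × ℕ => R p.1 p.2.1 p.2.2.1 p.2.2.2) {n : ℕ}
    (hn : ∀ x, ∃ y, ∀ w, R n x y w = false) : ¬ ComputablePred (· ∈ markedSet R n) := by
  classical
  intro hV
  have hcol : ComputablePred fun q : ℕ × ℕ => ¬ MarkedColumn R n q.1 q.2 := by
    refine (hV.comp (f := fun q : ℕ × ℕ => 2 * Nat.pair q.1 q.2)
      (Primrec.nat_mul.comp (Primrec.const 2)
        (Primrec₂.natPair.comp Primrec.fst Primrec.snd)).to_comp).not.of_eq fun q => ?_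
    simp [markedSet]
  choose b hb using hn
  have hfail (x : ℕ) : ∃ z, ¬ PassesTests R n x z := by
    refine ⟨(Finset.range (x + 1)).sup b + 1, ?_⟩
    rintro ⟨x', hx', h⟩
    obtain ⟨w, hw⟩ := h (b x')
      (Nat.lt_succ_of_le (Finset.le_sup (Finset.mem_range.2 (Nat.lt_succ_of_le hx'))))
    simp [hb] at hw
  have hex (x : ℕ) : ∃ z, ¬ MarkedColumn R n x z := by
    obtain ⟨z, hz⟩ := hfail x
    exact ⟨z + 1, fun h => hz (h.elim (fun h => h.anti (Nat.le_succ z)) fun h => h.2)⟩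
  have hfind := Computable.find hcol hex
  refine not_rePred_not_halts (((rePred_passesTests hR).comp ((Computable.const n).pair
    (Computable.id.pair (Computable.pred.comp hfind)))).of_eq fun x => ?_)
  have hspec := Nat.find_spec (hex x)
  constructor
  · exact fun h hK => hspec (.inr ⟨hK, h⟩)
  · intro hK
    have hpos : Nat.find (hex x) ≠ 0 := fun h0 => by
      rw [h0] at hspec
      exact hspec (.inl ⟨x, le_rfl, fun y hy => absurd hy (Nat.not_lt_zero y)⟩)
    have hmin := not_not.1 (Nat.find_min (hex x) (Nat.pred_lt hpos))
    exact hmin.resolve_right fun h => hK h.1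

end Hardness

theorem manyOneReducible_rpWordProblemIndices {A : Set ℕ} (hA : IsSigma03 A) :
    (· ∈ A) ≤₀ (· ∈ RPWordProblemIndices) := by
  obtain ⟨R, hR, hRA⟩ := hA
  have hV := rePred_markedSet hR
  have hunpair : Computable fun p : ℕ × ℕ => p.2.unpair :=
    Computable.unpair.comp Computable.snd
  have h₁ : REPred fun p : ℕ × ℕ => p.2.unpair.1 ∈ markedSet R p.1 :=
    REPred.comp hV (f := fun p : ℕ × ℕ => (p.1, p.2.unpair.1))
      (Computable.fst.pair (Computable.fst.comp hunpair))
  have h₂ : REPred fun p : ℕ × ℕ => p.2.unpair.2 ∈ markedSet R p.1 :=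
    REPred.comp hV (f := fun p : ℕ × ℕ => (p.1, p.2.unpair.2))
      (Computable.fst.pair (Computable.snd.comp hunpair))
  obtain ⟨f, hf, hfW⟩ := exists_index
    (p := fun n k => k.unpair.1 ∈ markedSet R n ∧ k.unpair.2 ∈ markedSet R n) (h₁.and h₂)
  refine ⟨f, hf, fun n => ?_⟩
  simp only [rpWordProblemIndices_eq, Set.mem_ofPred_eq, ceer_eq_collapse (hfW n)]
  constructor
  · intro hn
    obtain ⟨x, hx⟩ := (hRA n).1 hn
    exact exists_collapse_ceerEquiv (computablePred_markedSet hx) fun k hk => by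
      have := hk.1
      omega
  · rintro ⟨s, hs⟩
    by_contra hn
    rw [hRA] at hn
    push Not at hn
    exact not_computablePred_markedSet hR (by simpa using hn)
      (computablePred_of_collapse_ceerEquiv hs)

/-- The set of indices of ceers computably equivalent to the word problem of a recursively
presented group is Σ⁰₃-complete. -/
theorem RPWordProblemIndices_Sigma03Complete :
    IsSigma03 RPWordProblemIndices ∧
      ∀ A : Set ℕ, IsSigma03 A → (· ∈ A) ≤₀ (· ∈ RPWordProblemIndices) := by
  exact ⟨isSigma03_rpWordProblemIndices, fun _ => manyOneReducible_rpWordProblemIndices⟩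
end

section
/- There is a set S ⊆ ℕ such that S = [S], S is Δ⁰₄, S is proper on the infinite ceers, and S is neither Σ⁰₃-hard nor Π⁰₃-hard with respect to many-one reducibility (i.e., there is a Σ⁰₃ set that does not many-one reduce to S and a Π⁰₃ set that does not many-one reduce to S). -/
/-- A set is Π⁰₃ iff its complement is Σ⁰₃. -/
def IsPi03 (S : Set ℕ) : Prop := IsSigma03 Sᶜ

/-- A set `S ⊆ ℕ` is Σ⁰₄ if there is a computable predicate `R ⊆ ℕ⁵` with
`n ∈ S ↔ ∃x ∀y ∃z ∀w, R n x y z w`. -/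
def IsSigma04 (S : Set ℕ) : Prop :=
  ∃ R : ℕ → ℕ → ℕ → ℕ → ℕ → Bool,
    (Computable fun p : ℕ × ℕ × ℕ × ℕ × ℕ => R p.1 p.2.1 p.2.2.1 p.2.2.2.1 p.2.2.2.2) ∧
    ∀ n, n ∈ S ↔ ∃ x, ∀ y, ∃ z, ∀ w, R n x y z w = true

/-- A set is Π⁰₄ iff its complement is Σ⁰₄. -/
def IsPi04 (S : Set ℕ) : Prop := IsSigma04 Sᶜ

/-- A set is Δ⁰₄ iff it is both Σ⁰₄ and Π⁰₄. -/
def IsDelta04 (S : Set ℕ) : Prop := IsSigma04 S ∧ IsPi04 S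

section ArithmeticalHierarchy

variable {α β : Type} [Primcodable α] [Primcodable β]

theorem ComputablePred.comp_computable {p : β → Prop} (hp : ComputablePred p) {f : α → β}
    (hf : Computable f) : ComputablePred fun a => p (f a) := by
  obtain ⟨_, h⟩ := hp
  exact ⟨fun a => inferInstance, h.comp hf⟩

theorem ComputablePred.and_computablePred {p q : α → Prop} (hp : ComputablePred p)
    (hq : ComputablePred q) : ComputablePred fun a => p a ∧ q a := by
  obtain ⟨_, h⟩ := hp
  obtain ⟨_, h'⟩ := hq
  exact ⟨fun a => inferInstance,
    (Primrec.and.to_comp.comp h h').of_eq fun a => (Bool.decide_and _ _).symm⟩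

/-- `SigmaPred n p` says that the predicate `p` is Σ⁰ₙ, where Σ⁰₀ means computable. -/
def SigmaPred : ℕ → {α : Type} → [Primcodable α] → (α → Prop) → Prop
  | 0, _, _, p => ComputablePred p
  | n + 1, α, _, p => ∃ q : α × ℕ → Prop, SigmaPred n (fun a => ¬q a) ∧ ∀ a, p a ↔ ∃ x, q (a, x)

namespace SigmaPred

variable {n : ℕ}

theorem of_eq {p q : α → Prop} (hp : SigmaPred n p) (h : ∀ a, p a ↔ q a) : SigmaPred n q := by
  rwa [← funext fun a => propext (h a)]

theorem not_not {p : α → Prop} (hp : SigmaPred n p) : SigmaPred n fun a => ¬¬p a :=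
  hp.of_eq fun _ => Classical.not_not.symm

theorem comp : ∀ {n : ℕ} {α β : Type} [Primcodable α] [Primcodable β] {p : β → Prop},
    SigmaPred n p → ∀ {f : α → β}, Computable f → SigmaPred n fun a => p (f a)
  | 0, _, _, _, _, _, hp, _, hf => ComputablePred.comp_computable hp hf
  | _ + 1, α, _, _, _, _, ⟨q, hq, h⟩, f, hf =>
    ⟨fun a => q (f a.1, a.2),
      comp hq (f := fun a : α × ℕ => (f a.1, a.2)) ((hf.comp Computable.fst).pair Computable.snd),
      fun a => h (f a)⟩

/-- Every Π⁰ₙ predicate is Σ⁰ₙ₊₁. -/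
theorem of_not {p : α → Prop} (hp : SigmaPred n fun a => ¬p a) : SigmaPred (n + 1) p :=
  ⟨fun a => p a.1, hp.comp Computable.fst, fun a => by simp⟩

theorem not_succ {p : α → Prop} (hp : SigmaPred n p) : SigmaPred (n + 1) fun a => ¬p a :=
  of_not hp.not_not

theorem succ : ∀ {n : ℕ} {α : Type} [Primcodable α] {p : α → Prop},
    SigmaPred n p → SigmaPred (n + 1) p
  | 0, _, _, _, hp => of_not (ComputablePred.not hp)
  | _ + 1, _, _, _, ⟨q, hq, h⟩ => ⟨q, hq.succ, h⟩

theorem of_computable {p : α → Prop} (hp : ComputablePred p) : ∀ n, SigmaPred n p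
  | 0 => hp
  | n + 1 => (of_computable hp n).succ

theorem exists_iff_exists_not {p : α → Prop} (hp : SigmaPred (n + 1) p) :
    ∃ q : α × ℕ → Prop, SigmaPred n q ∧ ∀ a, p a ↔ ∃ x, ¬q (a, x) := by
  obtain ⟨q, hq, h⟩ := hp
  exact ⟨fun a => ¬q a, hq, fun a => by simp [h]⟩

theorem and_or : ∀ {n : ℕ} {α : Type} [Primcodable α] {p q : α → Prop},
    SigmaPred n p → SigmaPred n q →
      (SigmaPred n fun a => p a ∧ q a) ∧ SigmaPred n fun a => p a ∨ q a
  | 0, _, _, _, _, hp, hq =>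
    ⟨ComputablePred.and_computablePred hp hq,
      (ComputablePred.not (ComputablePred.and_computablePred (ComputablePred.not hp)
        (ComputablePred.not hq))).of_eq fun a => by tauto⟩
  | _ + 1, α, _, _, _, ⟨p, hp, hpe⟩, ⟨q, hq, hqe⟩ => by
    have c₁ : Computable fun a : α × ℕ => (a.1, a.2.unpair.1) :=
      Computable.fst.pair (Computable.fst.comp (Computable.unpair.comp Computable.snd))
    have c₂ : Computable fun a : α × ℕ => (a.1, a.2.unpair.2) :=
      Computable.fst.pair (Computable.snd.comp (Computable.unpair.comp Computable.snd))
    refine ⟨⟨fun a => p (a.1, a.2.unpair.1) ∧ q (a.1, a.2.unpair.2), ?_, fun a => ?_⟩,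
      ⟨fun a => p a ∨ q a, ?_, fun a => ?_⟩⟩
    · exact (and_or (comp hp c₁) (comp hq c₂)).2.of_eq fun a => by tauto
    · beta_reduce
      rw [hpe, hqe]
      constructor
      · rintro ⟨⟨x, hx⟩, y, hy⟩
        exact ⟨Nat.pair x y, by simpa using ⟨hx, hy⟩⟩
      · rintro ⟨z, hx, hy⟩
        exact ⟨⟨_, hx⟩, _, hy⟩
    · exact (and_or hp hq).1.of_eq fun a => by tauto
    · beta_reduce
      rw [hpe, hqe, exists_or]

theorem and {p q : α → Prop} (hp : SigmaPred n p) (hq : SigmaPred n q) :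
    SigmaPred n fun a => p a ∧ q a :=
  (and_or hp hq).1

theorem or {p q : α → Prop} (hp : SigmaPred n p) (hq : SigmaPred n q) :
    SigmaPred n fun a => p a ∨ q a :=
  (and_or hp hq).2

theorem exists_nat {p : α × ℕ → Prop} (hp : SigmaPred (n + 1) p) :
    SigmaPred (n + 1) fun a => ∃ x, p (a, x) := by
  obtain ⟨q, hq, h⟩ := hp
  refine ⟨fun a => q ((a.1, a.2.unpair.1), a.2.unpair.2), hq.comp ?_, fun a => ?_⟩
  · have := Computable.unpair.comp (Computable.snd (α := α) (β := ℕ))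
    exact (Computable.fst.pair (Computable.fst.comp this)).pair (Computable.snd.comp this)
  · constructor
    · rintro ⟨x, hx⟩
      obtain ⟨y, hy⟩ := (h _).1 hx
      exact ⟨Nat.pair x y, by simpa using hy⟩
    · rintro ⟨z, hz⟩
      exact ⟨_, (h _).2 ⟨_, hz⟩⟩

theorem exists_of_inhabited [Inhabited β] {p : α × β → Prop} (hp : SigmaPred (n + 1) p) :
    SigmaPred (n + 1) fun a => ∃ b, p (a, b) := by
  have c : Computable fun a : α × ℕ => (a.1, (Encodable.decode (α := β) a.2).getD default) :=
    Computable.fst.pair (Computable.option_getD (Computable.decode.comp Computable.snd)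
      (Computable.const default))
  refine (hp.comp c).exists_nat.of_eq fun a => ⟨fun ⟨_, h⟩ => ⟨_, h⟩, fun ⟨b, h⟩ =>
    ⟨Encodable.encode b, ?_⟩⟩
  simpa using h

theorem not_forall_of_inhabited [Inhabited β] {p : α × β → Prop}
    (hp : SigmaPred (n + 1) fun a => ¬p a) : SigmaPred (n + 1) fun a => ¬∀ b, p (a, b) :=
  hp.exists_of_inhabited.of_eq fun a => by push Not; rfl

theorem forall_of_inhabited [Inhabited β] {p : α × β → Prop}
    (hp : SigmaPred (n + 1) fun a => ¬p a) : SigmaPred (n + 2) fun a => ∀ b, p (a, b) :=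
  hp.not_forall_of_inhabited.of_not

theorem computablePred_lt {f g : α → ℕ} (hf : Computable f) (hg : Computable g) :
    ComputablePred fun a => f a < g a :=
  (PrimrecPred.computablePred Primrec.nat_lt).comp_computable (hf.pair hg)

theorem computablePred_eq {f g : α → β} (hf : Computable f) (hg : Computable g) :
    ComputablePred fun a => f a = g a :=
  (PrimrecPred.computablePred Primrec.eq).comp_computable (hf.pair hg)

theorem forall_lt {p : α × ℕ → Prop} (hp : SigmaPred (n + 2) p) {f : α → ℕ}
    (hf : Computable f) : SigmaPred (n + 2) fun a => ∀ i < f a, p (a, i) := by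
  obtain ⟨q, hq, h⟩ := hp
  have c : Computable fun b : (α × List ℕ) × ℕ => ((b.1.1, b.2), b.1.2.getD b.2 0) := by
    refine ((Computable.fst.comp Computable.fst).pair Computable.snd).pair ?_
    exact (Primrec.list_getD 0).to_comp.comp (Computable.snd.comp Computable.fst) Computable.snd
  have hlt : SigmaPred (n + 1) fun b : (α × List ℕ) × ℕ => b.2 < f b.1.1 :=
    of_computable (computablePred_lt Computable.snd
      (hf.comp (Computable.fst.comp Computable.fst))) _
  have key : SigmaPred (n + 1) fun b : (α × List ℕ) × ℕ =>
      ¬(b.2 < f b.1.1 → q ((b.1.1, b.2), b.1.2.getD b.2 0)) :=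
    (hlt.and (hq.comp c)).of_eq fun a => by tauto
  refine key.forall_of_inhabited.exists_of_inhabited.of_eq fun a => ⟨?_, fun H => ?_⟩
  · rintro ⟨l, hl⟩ i hi
    exact (h _).2 ⟨_, hl i hi⟩
  · choose! g hg using fun i hi => (h (a, i)).1 (H i hi)
    refine ⟨(List.range (f a)).map g, fun i hi => ?_⟩
    have hi : i < f a := hi
    simpa [List.getD, hi] using hg i hi

/-- Uniformization: a total Σ⁰ₙ relation with values in `ℕ` contains the graph of a function,
with Σ⁰ₙ graph. -/
theorem exists_uniformization {p : α × ℕ → Prop} (hp : SigmaPred (n + 2) p)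
    (htot : ∀ a, ∃ x, p (a, x)) :
    ∃ f : α → ℕ, (∀ a, p (a, f a)) ∧ SigmaPred (n + 2) fun a : α × ℕ => a.2 = f a.1 := by
  classical
  obtain ⟨q, hq, h⟩ := hp
  let r : α → ℕ → Prop := fun a w => q ((a, w.unpair.1), w.unpair.2)
  have c : Computable fun a : α × ℕ => ((a.1, a.2.unpair.1), a.2.unpair.2) := by
    have := Computable.unpair.comp (Computable.snd (α := α) (β := ℕ))
    exact (Computable.fst.pair (Computable.fst.comp this)).pair (Computable.snd.comp this)
  have hr : SigmaPred (n + 1) fun a : α × ℕ => ¬r a.1 a.2 := hq.comp c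
  have hex : ∀ a, ∃ w, r a w := fun a => by
    obtain ⟨x, hx⟩ := htot a
    obtain ⟨y, hy⟩ := (h _).1 hx
    exact ⟨Nat.pair x y, by simpa [r] using hy⟩
  refine ⟨fun a => (Nat.find (hex a)).unpair.1, fun a => (h _).2 ⟨_, Nat.find_spec (hex a)⟩, ?_⟩
  have c' : Computable fun b : ((α × ℕ) × ℕ) × ℕ => (b.1.1.1, b.2) :=
    (Computable.fst.comp (Computable.fst.comp Computable.fst)).pair Computable.snd
  have h₁ : SigmaPred (n + 2) fun b : (α × ℕ) × ℕ => ∀ i < b.2, ¬r b.1.1 i :=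
    (hr.comp c').succ.forall_lt Computable.snd
  have h₂ : SigmaPred (n + 2) fun b : (α × ℕ) × ℕ => r b.1.1 b.2 :=
    (hr.comp ((Computable.fst.comp Computable.fst).pair Computable.snd)).of_not
  have h₃ : SigmaPred (n + 2) fun b : (α × ℕ) × ℕ => b.1.2 = b.2.unpair.1 :=
    of_computable (computablePred_eq (Computable.snd.comp Computable.fst)
      (Computable.fst.comp (Computable.unpair.comp Computable.snd))) _
  refine (h₃.and (h₂.and h₁)).exists_nat.of_eq fun a => ⟨?_, fun H => ?_⟩
  · rintro ⟨w, e, hw⟩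
    have e : a.2 = w.unpair.1 := e
    simp only [e, (Nat.find_eq_iff (hex a.1)).2 hw]
  · exact ⟨_, H, Nat.find_spec (hex a.1), fun i hi => Nat.find_min (hex a.1) hi⟩

/-- Recursion along a total Σ⁰ₙ relation: there is a sequence of lists, each extending the previous
one by an admissible entry, whose range is Σ⁰ₙ. -/
theorem exists_history {p : List ℕ × ℕ → Prop} (hp : SigmaPred (n + 2) p)
    (htot : ∀ σ, ∃ x, p (σ, x)) :
    ∃ F : ℕ → List ℕ, F 0 = [] ∧ (∀ s, ∃ x, F (s + 1) = x :: F s ∧ p (F s, x)) ∧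
      SigmaPred (n + 2) fun σ => ∃ s, F s = σ := by
  obtain ⟨f, hf, hg⟩ := hp.exists_uniformization htot
  let F : ℕ → List ℕ := fun s => Nat.rec [] (fun _ σ => f σ :: σ) s
  refine ⟨F, rfl, fun s => ⟨f (F s), rfl, hf _⟩, ?_⟩
  have c : Computable fun a : List ℕ × ℕ => (a.1.drop (a.2 + 1), a.1.getD a.2 0) :=
    (Primrec.list_drop.to_comp.comp (Computable.succ.comp Computable.snd) Computable.fst).pair
      ((Primrec.list_getD 0).to_comp.comp Computable.fst Computable.snd)
  refine ((hg.comp c).forall_lt Primrec.list_length.to_comp).of_eq fun σ => ⟨fun H => ?_, ?_⟩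
  · induction σ with
    | nil => exact ⟨0, rfl⟩
    | cons x σ ih =>
      obtain ⟨s, rfl⟩ := ih fun i hi => by simpa using H (i + 1) (by simpa using hi)
      have := H 0 (by simp)
      exact ⟨s + 1, by simpa [F] using this.symm⟩
  · rintro ⟨s, rfl⟩
    induction s with
    | zero => simp [F]
    | succ s ih =>
      intro i hi
      cases i with
      | zero => simp [F]
      | succ i =>
        have := ih i (by simpa [F] using hi)
        simpa [F] using this

end SigmaPred

end ArithmeticalHierarchy

section Enumerations

open Nat.Partrec (Code)

theorem sigmaPred_one_eval :
    SigmaPred 1 fun p : ℕ × ℕ × ℕ => p.2.2 ∈ (Denumerable.ofNat Code p.1).eval p.2.1 := by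
  have c : Computable fun p : (ℕ × ℕ × ℕ) × ℕ =>
      Code.evaln p.2 (Denumerable.ofNat Code p.1.1) p.1.2.1 :=
    (Code.primrec_evaln.comp ((Primrec.snd.pair ((Primrec.ofNat Code).comp
      (Primrec.fst.comp Primrec.fst))).pair
        (Primrec.fst.comp (Primrec.snd.comp Primrec.fst)))).to_comp
  have c' : Computable fun p : (ℕ × ℕ × ℕ) × ℕ => some p.1.2.2 :=
    Computable.option_some.comp (Computable.snd.comp (Computable.snd.comp Computable.fst))
  refine ((SigmaPred.of_computable (SigmaPred.computablePred_eq c c') 1).exists_nat).of_eq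
    fun p => ?_
  rw [Code.evaln_complete]
  rfl

theorem sigmaPred_one_mem_W : SigmaPred 1 fun p : ℕ × ℕ => p.2 ∈ W p.1 := by
  have c : Computable fun p : (ℕ × ℕ) × ℕ => (p.1.1, p.1.2, p.2) :=
    (Computable.fst.comp Computable.fst).pair
      ((Computable.snd.comp Computable.fst).pair Computable.snd)
  exact (sigmaPred_one_eval.comp c).exists_nat.of_eq fun p =>
    (Part.dom_iff_mem (o := (Denumerable.ofNat Code p.1).eval p.2)).symm

theorem SigmaPred.exists_W_eq {p : ℕ → Prop} (hp : SigmaPred 1 p) : ∃ e, ∀ n, n ∈ W e ↔ p n := by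
  obtain ⟨q, hq, h⟩ := hp
  obtain ⟨_, hq⟩ := (ComputablePred.not hq).of_eq fun _ => Classical.not_not
  have hr : Partrec fun n : ℕ => Nat.rfind fun x => Part.some (decide (q (n, x))) :=
    Partrec.rfind hq.partrec
  obtain ⟨c, hc⟩ := Code.exists_code.1 (Partrec.nat_iff.1 hr)
  refine ⟨Encodable.encode c, fun n => ?_⟩
  have hW : n ∈ W (Encodable.encode c) ↔
      (Nat.rfind fun x => Part.some (decide (q (n, x)))).Dom := by simp [W, hc]
  rw [hW, h]
  exact Nat.rfind_dom.trans (by simp)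

/-- A Σ⁰₃ set whose complement is not Σ⁰₃. -/
theorem exists_sigmaPred_three_not_pi :
    ∃ A : Set ℕ, SigmaPred 3 (· ∈ A) ∧ ¬SigmaPred 3 (· ∉ A) := by
  let U : ℕ → ℕ → Prop := fun e n => ∃ x, ∀ y, Nat.pair (Nat.pair n x) y ∈ W e
  have hU : ∀ p : ℕ → Prop, SigmaPred 3 p → ∃ e, ∀ n, U e n ↔ p n := by
    intro p hp
    obtain ⟨q, hq, h⟩ := hp.exists_iff_exists_not
    obtain ⟨r, hr, h'⟩ := hq.exists_iff_exists_not
    have c : Computable fun m : ℕ =>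
        ((m.unpair.1.unpair.1, m.unpair.1.unpair.2), m.unpair.2) := by
      have h₁ := Computable.fst.comp Computable.unpair
      have h₂ := Computable.unpair.comp h₁
      exact ((Computable.fst.comp h₂).pair (Computable.snd.comp h₂)).pair
        (Computable.snd.comp Computable.unpair)
    obtain ⟨e, he⟩ := (hr.comp c).exists_W_eq
    exact ⟨e, fun n => by simp [U, h, h', he]⟩
  refine ⟨{e | U e e}, ?_, fun hA => ?_⟩
  · have c : Computable fun b : (ℕ × ℕ) × ℕ => (b.1.1, Nat.pair (Nat.pair b.1.1 b.1.2) b.2) :=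
      (Computable.fst.comp Computable.fst).pair
        (Primrec₂.natPair.to_comp.comp (Primrec₂.natPair.to_comp.comp
          (Computable.fst.comp Computable.fst) (Computable.snd.comp Computable.fst))
          Computable.snd)
    exact ((sigmaPred_one_mem_W.comp c).not_succ.forall_of_inhabited).exists_nat
  · obtain ⟨e, he⟩ := hU _ hA
    have := he e
    simp at this

theorem SigmaPred.isSigma03 {S : Set ℕ} (hS : SigmaPred 3 (· ∈ S)) : IsSigma03 S := by
  obtain ⟨q₁, h₁, e₁⟩ := hS.exists_iff_exists_not
  obtain ⟨q₂, h₂, e₂⟩ := h₁.exists_iff_exists_not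
  obtain ⟨q₃, h₃, e₃⟩ := h₂.exists_iff_exists_not
  obtain ⟨_, h₃⟩ := ComputablePred.not h₃
  refine ⟨fun n x y z => decide ¬q₃ (((n, x), y), z), h₃.comp ?_, fun n => ?_⟩
  · have s₁ := Computable.snd (α := ℕ) (β := ℕ × ℕ × ℕ)
    have s₂ := Computable.snd.comp s₁
    exact ((Computable.fst.pair (Computable.fst.comp s₁)).pair (Computable.fst.comp s₂)).pair
      (Computable.snd.comp s₂)
  · simp [e₁, e₂, e₃]

theorem SigmaPred.isSigma04 {S : Set ℕ} (hS : SigmaPred 4 (· ∈ S)) : IsSigma04 S := by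
  obtain ⟨q₁, h₁, e₁⟩ := hS.exists_iff_exists_not
  obtain ⟨q₂, h₂, e₂⟩ := h₁.exists_iff_exists_not
  obtain ⟨q₃, h₃, e₃⟩ := h₂.exists_iff_exists_not
  obtain ⟨q₄, h₄, e₄⟩ := h₃.exists_iff_exists_not
  obtain ⟨_, h₄⟩ := h₄
  refine ⟨fun n x y z w => decide (q₄ ((((n, x), y), z), w)), h₄.comp ?_, fun n => ?_⟩
  · have s₁ := Computable.snd (α := ℕ) (β := ℕ × ℕ × ℕ × ℕ)
    have s₂ := Computable.snd.comp s₁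
    have s₃ := Computable.snd.comp s₂
    exact (((Computable.fst.pair (Computable.fst.comp s₁)).pair (Computable.fst.comp s₂)).pair
      (Computable.fst.comp s₃)).pair (Computable.snd.comp s₃)
  · simp [e₁, e₂, e₃, e₄]

end Enumerations

section Ceers

open Nat.Partrec (Code)

theorem CeerEquiv.symm {E F : ℕ → ℕ → Prop} (h : CeerEquiv E F) : CeerEquiv F E :=
  And.symm h

theorem ComputableReduction.trans {E F G : ℕ → ℕ → Prop} (h : ComputableReduction E F)
    (h' : ComputableReduction F G) : ComputableReduction E G := by
  obtain ⟨f, hf, hE⟩ := h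
  obtain ⟨g, hg, hF⟩ := h'
  exact ⟨g ∘ f, hg.comp hf, fun m n => (hE m n).trans (hF _ _)⟩

theorem CeerEquiv.refl (E : ℕ → ℕ → Prop) : CeerEquiv E E :=
  ⟨⟨id, Computable.id, fun _ _ => Iff.rfl⟩, ⟨id, Computable.id, fun _ _ => Iff.rfl⟩⟩

theorem CeerEquiv.trans {E F G : ℕ → ℕ → Prop} (h : CeerEquiv E F) (h' : CeerEquiv F G) :
    CeerEquiv E G :=
  ⟨h.1.trans h'.1, h'.2.trans h.2⟩

/-- One step along a path in the graph generating `ceer i`: from `m`, move to the first component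
of `w` if the edge is enumerated within the number of steps given by the second one. -/
def ceerStep (i m : ℕ) (w : ℕ × ℕ) : ℕ :=
  bif (Code.evaln w.2 (Denumerable.ofNat Code i) (Nat.pair m w.1)).isSome ||
    (Code.evaln w.2 (Denumerable.ofNat Code i) (Nat.pair w.1 m)).isSome then w.1 else m

theorem mem_W_iff_evaln {i n : ℕ} :
    n ∈ W i ↔ ∃ k, (Code.evaln k (Denumerable.ofNat Code i) n).isSome := by
  simp only [W, Set.mem_ofPred_eq, Part.dom_iff_mem, Code.evaln_complete, Option.isSome_iff_exists,
    Option.mem_def]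
  exact exists_comm

theorem exists_ceerStep_eq (i m : ℕ) (w : ℕ × ℕ) : ∃ w', ceerStep i (ceerStep i m w) w' = m := by
  unfold ceerStep
  cases h : (Code.evaln w.2 (Denumerable.ofNat Code i) (Nat.pair m w.1)).isSome ||
    (Code.evaln w.2 (Denumerable.ofNat Code i) (Nat.pair w.1 m)).isSome
  · exact ⟨w, by simp only [cond_false, h]⟩
  · exact ⟨(m, w.2), by rw [Bool.or_comm] at h; simp only [cond_true, h]⟩

theorem ceer_iff_exists_foldl {i m n : ℕ} :
    ceer i m n ↔ ∃ l : List (ℕ × ℕ), l.foldl (ceerStep i) m = n := by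
  constructor
  · intro h
    induction h with
    | rel m n h =>
      obtain ⟨k, hk⟩ := mem_W_iff_evaln.1 h
      exact ⟨[(n, k)], by simp [ceerStep, hk]⟩
    | refl m => exact ⟨[], rfl⟩
    | symm m n _ ih =>
      obtain ⟨l, rfl⟩ := ih
      clear * -
      induction l generalizing m with
      | nil => exact ⟨[], rfl⟩
      | cons w l ih =>
        obtain ⟨l', hl'⟩ := ih (ceerStep i m w)
        obtain ⟨w', hw'⟩ := exists_ceerStep_eq i m w
        exact ⟨l' ++ [w'], by simp [hl', hw']⟩
    | trans m n k _ _ ih₁ ih₂ =>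
      obtain ⟨l, rfl⟩ := ih₁
      obtain ⟨l', rfl⟩ := ih₂
      exact ⟨l ++ l', by simp⟩
  · rintro ⟨l, rfl⟩
    induction l generalizing m with
    | nil => exact Relation.EqvGen.refl _
    | cons w l ih =>
      refine Relation.EqvGen.trans _ _ _ ?_ ih
      unfold ceerStep
      cases h₁ : (Code.evaln w.2 (Denumerable.ofNat Code i) (Nat.pair m w.1)).isSome
      · cases h₂ : (Code.evaln w.2 (Denumerable.ofNat Code i) (Nat.pair w.1 m)).isSome
        · exact Relation.EqvGen.refl _
        · exact (Relation.EqvGen.rel _ _ (mem_W_iff_evaln.2 ⟨_, h₂⟩)).symm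
      · exact Relation.EqvGen.rel _ _ (mem_W_iff_evaln.2 ⟨_, h₁⟩)

theorem primrec_ceerStep : Primrec fun b : ℕ × ℕ × (ℕ × ℕ) => ceerStep b.1 b.2.1 b.2.2 := by
  unfold ceerStep
  have m : Primrec fun b : ℕ × ℕ × (ℕ × ℕ) => b.2.1 := Primrec.fst.comp Primrec.snd
  have w : Primrec fun b : ℕ × ℕ × (ℕ × ℕ) => b.2.2.1 :=
    Primrec.fst.comp (Primrec.snd.comp Primrec.snd)
  have kc : Primrec fun b : ℕ × ℕ × (ℕ × ℕ) => (b.2.2.2, Denumerable.ofNat Code b.1) :=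
    (Primrec.snd.comp (Primrec.snd.comp Primrec.snd)).pair ((Primrec.ofNat Code).comp Primrec.fst)
  have h₁ : Primrec fun b : ℕ × ℕ × (ℕ × ℕ) =>
      (Code.evaln b.2.2.2 (Denumerable.ofNat Code b.1) (Nat.pair b.2.1 b.2.2.1)).isSome :=
    Primrec.option_isSome.comp (Code.primrec_evaln.comp (kc.pair (Primrec₂.natPair.comp m w)))
  have h₂ : Primrec fun b : ℕ × ℕ × (ℕ × ℕ) =>
      (Code.evaln b.2.2.2 (Denumerable.ofNat Code b.1) (Nat.pair b.2.2.1 b.2.1)).isSome :=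
    Primrec.option_isSome.comp (Code.primrec_evaln.comp (kc.pair (Primrec₂.natPair.comp w m)))
  exact Primrec.cond (Primrec.or.comp h₁ h₂) w m

theorem sigmaPred_one_ceer : SigmaPred 1 fun p : ℕ × ℕ × ℕ => ceer p.1 p.2.1 p.2.2 := by
  have hstep : Primrec₂ fun (b : (ℕ × ℕ × ℕ) × List (ℕ × ℕ)) (s : ℕ × (ℕ × ℕ)) =>
      ceerStep b.1.1 s.1 s.2 :=
    (primrec_ceerStep.comp
      ((Primrec.fst.comp (Primrec.fst.comp Primrec.fst)).pair Primrec.snd)).to₂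
  have m : Primrec fun b : (ℕ × ℕ × ℕ) × List (ℕ × ℕ) => b.1.2.1 :=
    Primrec.fst.comp (Primrec.snd.comp Primrec.fst)
  have l : Primrec fun b : (ℕ × ℕ × ℕ) × List (ℕ × ℕ) => b.2 := Primrec.snd
  have c : Primrec fun b : (ℕ × ℕ × ℕ) × List (ℕ × ℕ) => b.2.foldl (ceerStep b.1.1) b.1.2.1 :=
    Primrec.list_foldl l m hstep
  have c' : Computable fun b : (ℕ × ℕ × ℕ) × List (ℕ × ℕ) => b.1.2.2 :=
    Computable.snd.comp (Computable.snd.comp Computable.fst)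
  have h : SigmaPred 1 fun b : (ℕ × ℕ × ℕ) × List (ℕ × ℕ) =>
      b.2.foldl (ceerStep b.1.1) b.1.2.1 = b.1.2.2 :=
    SigmaPred.of_computable (SigmaPred.computablePred_eq c.to_comp c') 1
  refine h.exists_of_inhabited.of_eq fun p => ?_
  exact (ceer_iff_exists_foldl (i := p.1) (m := p.2.1) (n := p.2.2)).symm

theorem exists_code_of_computable {f : ℕ → ℕ} (hf : Computable f) :
    ∃ e, ∀ n v, v ∈ (Denumerable.ofNat Code e).eval n ↔ v = f n := by
  obtain ⟨c, hc⟩ := Code.exists_code.1 (Partrec.nat_iff.1 hf.partrec)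
  exact ⟨Encodable.encode c, fun n v => by simp [hc]⟩

/-- The `e`-th partial computable function is total. -/
def TotalCode (e : ℕ) : Prop := ∀ n, ∃ v, v ∈ (Denumerable.ofNat Code e).eval n

theorem TotalCode.exists_computable {e : ℕ} (he : TotalCode e) :
    ∃ f : ℕ → ℕ, Computable f ∧ ∀ n, f n ∈ (Denumerable.ofNat Code e).eval n := by
  choose f hf using he
  refine ⟨f, ?_, hf⟩
  have h : Partrec (Denumerable.ofNat Code e).eval :=
    Partrec.nat_iff.2 (Code.exists_code.2 ⟨_, rfl⟩)
  exact h.of_eq fun n => Part.eq_some_iff.2 (hf n)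

theorem sigmaPred_two_not_totalCode : SigmaPred 2 fun e => ¬TotalCode e := by
  have c : Computable fun b : (ℕ × ℕ) × ℕ => (b.1.1, b.1.2, b.2) :=
    (Computable.fst.comp Computable.fst).pair
      ((Computable.snd.comp Computable.fst).pair Computable.snd)
  exact (sigmaPred_one_eval.comp c).exists_nat.not_succ.not_forall_of_inhabited

theorem computableReduction_iff {E F : ℕ → ℕ → Prop} :
    ComputableReduction E F ↔ ∃ e, TotalCode e ∧ ∀ b : (ℕ × ℕ) × (ℕ × ℕ),
      ¬((b.1.2 ∈ (Denumerable.ofNat Code e).eval b.1.1 ∧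
          b.2.2 ∈ (Denumerable.ofNat Code e).eval b.2.1) ∧
        ((E b.1.1 b.2.1 ∧ ¬F b.1.2 b.2.2) ∨ (F b.1.2 b.2.2 ∧ ¬E b.1.1 b.2.1))) := by
  constructor
  · rintro ⟨f, hf, h⟩
    obtain ⟨e, he⟩ := exists_code_of_computable hf
    refine ⟨e, fun n => ⟨f n, (he _ _).2 rfl⟩, ?_⟩
    rintro ⟨⟨m, u⟩, n, v⟩
    simp only [he, h]
    rintro ⟨⟨rfl, rfl⟩, h⟩
    tauto
  · rintro ⟨e, he, h⟩
    obtain ⟨f, hf, hfe⟩ := he.exists_computable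
    refine ⟨f, hf, fun m n => ?_⟩
    have := h ((m, f m), (n, f n))
    simp only [hfe, true_and] at this
    tauto

theorem sigmaPred_three_computableReduction :
    SigmaPred 3 fun p : ℕ × ℕ => ComputableReduction (ceer p.1) (ceer p.2) := by
  have x₁ : Computable fun a : ((ℕ × ℕ) × ℕ) × ((ℕ × ℕ) × (ℕ × ℕ)) => a.1 := Computable.fst
  have b : Computable fun a : ((ℕ × ℕ) × ℕ) × ((ℕ × ℕ) × (ℕ × ℕ)) => a.2 := Computable.snd
  have e := Computable.snd.comp x₁
  have i := Computable.fst.comp (Computable.fst.comp x₁)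
  have j := Computable.snd.comp (Computable.fst.comp x₁)
  have m := Computable.fst.comp (Computable.fst.comp b)
  have u := Computable.snd.comp (Computable.fst.comp b)
  have n := Computable.fst.comp (Computable.snd.comp b)
  have v := Computable.snd.comp (Computable.snd.comp b)
  have g₁ := (sigmaPred_one_eval.comp (e.pair (m.pair u))).succ
  have g₂ := (sigmaPred_one_eval.comp (e.pair (n.pair v))).succ
  have c₁ := sigmaPred_one_ceer.comp (i.pair (m.pair n))
  have c₂ := sigmaPred_one_ceer.comp (j.pair (u.pair v))
  have key := (g₁.and g₂).and ((c₁.succ.and c₂.not_succ).or (c₂.succ.and c₁.not_succ))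
  exact ((sigmaPred_two_not_totalCode.comp Computable.snd).of_not.and
    key.not_not.forall_of_inhabited).exists_nat.of_eq fun p =>
      (computableReduction_iff (E := ceer p.1) (F := ceer p.2)).symm

theorem sigmaPred_three_ceerEquiv :
    SigmaPred 3 fun p : ℕ × ℕ => CeerEquiv (ceer p.1) (ceer p.2) :=
  sigmaPred_three_computableReduction.and
    (sigmaPred_three_computableReduction.comp (Computable.snd.pair Computable.fst))

/-- The identity and the ceer collapsing a noncomputable c.e. set with infinite complement. -/
theorem exists_infinite_ceers_not_equiv :
    ∃ i j, HasInfinitelyManyClasses (ceer i) ∧ HasInfinitelyManyClasses (ceer j) ∧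
      ¬CeerEquiv (ceer j) (ceer i) := by
  obtain ⟨i, hi⟩ := (SigmaPred.of_computable (ComputablePred.computable_iff.2
    ⟨fun _ : ℕ => false, Computable.const _, rfl⟩) 1).exists_W_eq
  obtain ⟨e, he⟩ := (SigmaPred.of_computable (ComputablePred.computable_iff.2
    ⟨fun _ : ℕ => true, Computable.const _, rfl⟩) 1).exists_W_eq
  let K : ℕ → Prop := fun x => x.unpair.1 = 0 ∧ 0 ∈ W x.unpair.2
  have u₁ := Computable.fst.comp Computable.unpair
  have u₂ := Computable.snd.comp Computable.unpair
  have hK : SigmaPred 1 K :=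
    (SigmaPred.of_computable (SigmaPred.computablePred_eq u₁ (Computable.const 0)) 1).and
      (sigmaPred_one_mem_W.comp (u₂.pair (Computable.const 0)))
  obtain ⟨j, hj⟩ := ((hK.comp u₁).and (hK.comp u₂)).exists_W_eq
  have hci : ∀ {m n}, ceer i m n ↔ m = n := by
    refine ⟨fun h => ?_, fun h => h ▸ Relation.EqvGen.refl _⟩
    induction h with
    | rel m n h => simpa using (hi _).1 h
    | refl => rfl
    | symm _ _ _ ih => exact ih.symm
    | trans _ _ _ _ _ ih₁ ih₂ => exact ih₁.trans ih₂
  have hcj : ∀ {m n}, ceer j m n ↔ m = n ∨ K m ∧ K n := by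
    refine ⟨fun h => ?_, ?_⟩
    · induction h with
      | rel m n h => exact Or.inr (by simpa using (hj _).1 h)
      | refl => exact Or.inl rfl
      | symm _ _ _ ih => exact ih.imp Eq.symm And.symm
      | trans _ _ _ _ _ ih₁ ih₂ =>
        rcases ih₁ with rfl | ih₁
        · exact ih₂
        · rcases ih₂ with rfl | ih₂
          · exact Or.inr ih₁
          · exact Or.inr ⟨ih₁.1, ih₂.2⟩
    · rintro (rfl | h)
      · exact Relation.EqvGen.refl _
      · exact Relation.EqvGen.rel _ _ ((hj _).2 (by simpa using h))
  refine ⟨i, j, ⟨id, fun m n h h' => h (hci.1 h')⟩, ⟨fun m => Nat.pair 1 m, fun m n h h' => ?_⟩, ?_⟩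
  · rcases hcj.1 h' with h' | h'
    · exact h (Nat.pair_eq_pair.1 h').2
    · simpa [K] using h'.1.1
  · rintro ⟨⟨f, hf, h⟩, -⟩
    refine ComputablePred.halting_problem 0 (ComputablePred.of_eq (SigmaPred.computablePred_eq
      (hf.comp (Primrec₂.natPair.to_comp.comp (Computable.const 0) Computable.encode))
      (Computable.const (f (Nat.pair 0 e)))) fun c => ?_)
    have hKe : K (Nat.pair 0 e) := by simp [K, he]
    have hKc : K (Nat.pair 0 (Encodable.encode c)) ↔ (c.eval 0).Dom := by simp [K, W]
    rw [← hci, ← h, hcj, ← hKc]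
    exact ⟨fun H => H.elim (fun H => H ▸ hKe) And.left, fun H => Or.inr ⟨H, hKe⟩⟩

end Ceers

section Construction

open Nat.Partrec (Code)

/-- A finite list of decisions, where `Nat.bit b i` puts the ceers equivalent to `ceer i` into
(`b = true`) or out of (`b = false`) a set of indices, decides `i` as `b`. -/
def Decides (b : Bool) (σ : List ℕ) (i : ℕ) : Prop :=
  ∃ d ∈ σ, d.bodd = b ∧ CeerEquiv (ceer i) (ceer d.div2)

theorem Decides.mono {b : Bool} {σ τ : List ℕ} {i : ℕ} (h : Decides b σ i) (hστ : σ ⊆ τ) :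
    Decides b τ i := by
  obtain ⟨d, hd, h⟩ := h
  exact ⟨d, hστ hd, h⟩

theorem Decides.congr {b : Bool} {σ : List ℕ} {i j : ℕ} (h : Decides b σ i)
    (hij : CeerEquiv (ceer j) (ceer i)) : Decides b σ j := by
  obtain ⟨d, hd, hb, h⟩ := h
  exact ⟨d, hd, hb, hij.trans h⟩

theorem sigmaPred_three_decides {α : Type} [Primcodable α] (b : Bool) {σ : α → List ℕ} {i : α → ℕ}
    (hσ : Computable σ) (hi : Computable i) : SigmaPred 3 fun a => Decides b (σ a) (i a) := by
  have p₁ : Computable fun a : (α × ℕ) × ℕ => a.1.1 := Computable.fst.comp Computable.fst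
  have k : Computable fun a : (α × ℕ) × ℕ => a.1.2 := Computable.snd.comp Computable.fst
  have d : Computable fun a : (α × ℕ) × ℕ => a.2 := Computable.snd
  have h₁ := SigmaPred.of_computable (SigmaPred.computablePred_eq
    (Primrec.list_getElem?.to_comp.comp (hσ.comp p₁) k) (Computable.option_some.comp d)) 3
  have h₂ := SigmaPred.of_computable (SigmaPred.computablePred_eq
    (Computable.nat_bodd.comp d) (Computable.const b)) 3
  have h₃ := sigmaPred_three_ceerEquiv.comp ((hi.comp p₁).pair (Computable.nat_div2.comp d))
  refine (h₁.and (h₂.and h₃)).exists_nat.exists_nat.of_eq fun a => ?_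
  rw [exists_comm]
  simp only [exists_and_right, Decides, List.mem_iff_getElem?]

/-- A list of decisions is inconsistent if some index is decided both ways. -/
def Inconsistent (σ : List ℕ) : Prop := ∃ i, Decides true σ i ∧ Decides false σ i

theorem sigmaPred_three_inconsistent {α : Type} [Primcodable α] {σ : α → List ℕ}
    (hσ : Computable σ) : SigmaPred 3 fun a => Inconsistent (σ a) :=
  ((sigmaPred_three_decides true (hσ.comp Computable.fst) Computable.snd).and
    (sigmaPred_three_decides false (hσ.comp Computable.fst) Computable.snd)).exists_nat

theorem Inconsistent.of_cons {σ : List ℕ} {d : ℕ} (h : Inconsistent (d :: σ)) :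
    Inconsistent σ ∨ Decides (!d.bodd) σ d.div2 := by
  obtain ⟨i, ⟨c, hc, hcb, hci⟩, c', hc', hcb', hci'⟩ := h
  rcases List.mem_cons.1 hc with rfl | mc
  · rcases List.mem_cons.1 hc' with rfl | mc'
    · simp [hcb] at hcb'
    · exact Or.inr ⟨c', mc', by simp [hcb, hcb'], hci.symm.trans hci'⟩
  · rcases List.mem_cons.1 hc' with rfl | mc'
    · exact Or.inr ⟨c, mc, by simp [hcb, hcb'], hci'.symm.trans hci⟩
    · exact Or.inl ⟨i, ⟨c, mc, hcb, hci⟩, c', mc', hcb', hci'⟩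

/-- The decision `d` acts as required at stage `s`: it decides a given index, or it ensures that a
given computable function is no reduction of `A` or of its complement. -/
def Acts (A : Set ℕ) (s d : ℕ) : Prop :=
  (s.unpair.1 = 0 ∧ d.div2 = s.unpair.2) ∨
    (s.unpair.1 ≠ 0 ∧ (¬TotalCode s.unpair.2 ∨
      ∃ n, d.div2 ∈ (Denumerable.ofNat Code s.unpair.2).eval n ∧
        (n ∈ A ↔ (d.bodd = true ↔ s.unpair.1 = 1))))

theorem SigmaPred.iff {α : Type} [Primcodable α] {n : ℕ} {p q : α → Prop} (hp : SigmaPred n p)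
    (hp' : SigmaPred n fun a => ¬p a) (hq : SigmaPred n q) (hq' : SigmaPred n fun a => ¬q a) :
    SigmaPred n fun a => p a ↔ q a :=
  ((hp.and hq).or (hp'.and hq')).of_eq fun a => by tauto

theorem sigmaPred_four_acts {A : Set ℕ} (hA : SigmaPred 3 (· ∈ A)) :
    SigmaPred 4 fun p : ℕ × ℕ => Acts A p.1 p.2 := by
  have s : Computable fun a : (ℕ × ℕ) × ℕ => a.1.1 := Computable.fst.comp Computable.fst
  have d : Computable fun a : (ℕ × ℕ) × ℕ => a.1.2 := Computable.snd.comp Computable.fst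
  have k := Computable.fst.comp (Computable.unpair.comp s)
  have e := Computable.snd.comp (Computable.unpair.comp s)
  have n : Computable fun a : (ℕ × ℕ) × ℕ => a.2 := Computable.snd
  have i := Computable.nat_div2.comp d
  have hk : ∀ c, ComputablePred fun a : (ℕ × ℕ) × ℕ => a.1.1.unpair.1 = c := fun c =>
    SigmaPred.computablePred_eq k (Computable.const c)
  have hb : ComputablePred fun a : (ℕ × ℕ) × ℕ => a.1.2.bodd = true :=
    SigmaPred.computablePred_eq (Computable.nat_bodd.comp d) (Computable.const true)
  have h₀ := (SigmaPred.of_computable (hk 0) 4).and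
    (SigmaPred.of_computable (SigmaPred.computablePred_eq i e) 4)
  have h₁ := SigmaPred.of_computable (hk 0).not 4
  have h₂ := (sigmaPred_two_not_totalCode.comp e).succ.succ
  have h₃ := (sigmaPred_one_eval.comp (e.pair (n.pair i))).succ.succ.succ
  have h₄ := SigmaPred.iff (n := 0) hb hb.not (hk 1) (hk 1).not
  have hAn := hA.comp n
  have h₅ := SigmaPred.iff hAn.succ hAn.not_succ (SigmaPred.of_computable h₄ 4)
    (SigmaPred.of_computable (ComputablePred.not h₄) 4)
  refine (h₀.or (h₁.and (h₂.or (h₃.and h₅)))).exists_nat.of_eq fun p => ?_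
  simp only [Acts, exists_or, exists_const, exists_and_left]

theorem exists_acts {A : Set ℕ} (hA : ¬SigmaPred 3 (· ∉ A)) {σ : List ℕ}
    (hσ : ¬Inconsistent σ) (s : ℕ) : ∃ d, ¬Decides (!d.bodd) σ d.div2 ∧ Acts A s d := by
  have hdec : ∀ i, ∃ b, ¬Decides (!b) σ i := fun i => by
    by_cases h : Decides true σ i
    · exact ⟨true, fun h' => hσ ⟨i, h, h'⟩⟩
    · exact ⟨false, h⟩
  by_cases hs : s.unpair.1 = 0
  · obtain ⟨b, hb⟩ := hdec s.unpair.2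
    exact ⟨Nat.bit b s.unpair.2, by simpa using hb, Or.inl ⟨hs, by simp⟩⟩
  by_cases he : TotalCode s.unpair.2
  · obtain ⟨f, hf, hfe⟩ := he.exists_computable
    by_contra! H
    have key : ∀ n (b : Bool), (n ∈ A ↔ (b = true ↔ s.unpair.1 = 1)) → Decides (!b) σ (f n) := by
      intro n b hb
      by_contra h
      exact H (Nat.bit b (f n)) (by simpa using h)
        (Or.inr ⟨hs, Or.inr ⟨n, by simpa using hfe n, by simpa using hb⟩⟩)
    refine hA ?_
    by_cases h1 : s.unpair.1 = 1
    · refine (sigmaPred_three_decides true (Computable.const σ) hf).of_eq fun n =>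
        ⟨fun h hn => hσ ⟨f n, h, ?_⟩, fun hn => ?_⟩
      · exact key n true (by simp [hn, h1])
      · exact key n false (by simp [hn, h1])
    · refine (sigmaPred_three_decides false (Computable.const σ) hf).of_eq fun n =>
        ⟨fun h hn => hσ ⟨f n, ?_, h⟩, fun hn => ?_⟩
      · exact key n false (by simp [hn, h1])
      · exact key n true (by simp [hn, h1])
  · obtain ⟨b, hb⟩ := hdec 0
    exact ⟨Nat.bit b 0, by simpa using hb, Or.inr ⟨hs, Or.inl he⟩⟩

/-- For a consistent list of initial decisions and a Σ⁰₃ set `A` that is not Π⁰₃, a sequence of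
consistent decisions which acts at every stage. -/
theorem exists_decision_sequence {A : Set ℕ} (hA : SigmaPred 3 (· ∈ A))
    (hA' : ¬SigmaPred 3 (· ∉ A)) {ρ : List ℕ} (hρ : ¬Inconsistent ρ) :
    ∃ D : ℕ → List ℕ, D 0 = ρ ∧ (∀ s, ¬Inconsistent (D s)) ∧
      (∀ s, ∃ d, D (s + 1) = d :: D s ∧ Acts A s d) ∧
      ∀ b, SigmaPred 4 fun i => ∃ s, Decides b (D s) i := by
  let p : List ℕ × ℕ → Prop := fun a => Inconsistent (a.1 ++ ρ) ∨
    (¬Decides (!a.2.bodd) (a.1 ++ ρ) a.2.div2 ∧ Acts A a.1.length a.2)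
  have happ : Computable fun a : List ℕ × ℕ => a.1 ++ ρ :=
    Primrec.list_append.to_comp.comp Computable.fst (Computable.const ρ)
  have hdiv : Computable fun a : List ℕ × ℕ => a.2.div2 := Computable.nat_div2.comp Computable.snd
  have hbodd : ∀ b, SigmaPred 4 fun a : List ℕ × ℕ => a.2.bodd = b := fun b =>
    SigmaPred.of_computable (SigmaPred.computablePred_eq
      (Computable.nat_bodd.comp Computable.snd) (Computable.const b)) _
  have hp : SigmaPred 4 p := by
    have hD : SigmaPred 4 fun a : List ℕ × ℕ => ¬Decides (!a.2.bodd) (a.1 ++ ρ) a.2.div2 :=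
      (((hbodd true).and (sigmaPred_three_decides false happ hdiv).not_succ).or
        ((hbodd false).and (sigmaPred_three_decides true happ hdiv).not_succ)).of_eq fun a => by
          cases a.2.bodd <;> simp
    exact (sigmaPred_three_inconsistent happ).succ.or (hD.and ((sigmaPred_four_acts hA).comp
      ((Primrec.list_length.to_comp.comp Computable.fst).pair Computable.snd)))
  obtain ⟨F, hF0, hF, hFr⟩ := hp.exists_history fun σ => by
    by_cases hσ : Inconsistent (σ ++ ρ)
    · exact ⟨0, Or.inl hσ⟩
    · obtain ⟨d, hd⟩ := exists_acts hA' hσ σ.length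
      exact ⟨d, Or.inr hd⟩
  have hcon : ∀ s, ¬Inconsistent (F s ++ ρ) := by
    intro s
    induction s with
    | zero => simpa [hF0] using hρ
    | succ s ih =>
      obtain ⟨d, hd, h⟩ := hF s
      rw [hd]
      exact fun H => (Inconsistent.of_cons H).elim ih (h.resolve_left ih).1
  have hlen : ∀ s, (F s).length = s := by
    intro s
    induction s with
    | zero => simp [hF0]
    | succ s ih =>
      obtain ⟨d, hd, -⟩ := hF s
      simp [hd, ih]
  refine ⟨fun s => F s ++ ρ, by simp [hF0], hcon, fun s => ?_, fun b => ?_⟩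
  · obtain ⟨d, hd, h⟩ := hF s
    have := (h.resolve_left (hcon s)).2
    exact ⟨d, by simp [hd], by simpa [hlen] using this⟩
  · have h := (sigmaPred_three_decides b (Primrec.list_append.to_comp.comp
      (Computable.snd (α := ℕ) (β := List ℕ)) (Computable.const ρ)) Computable.fst).succ
    refine ((hFr.comp Computable.snd).and h).exists_of_inhabited.of_eq fun i => ⟨?_, ?_⟩
    · rintro ⟨_, ⟨s, rfl⟩, h⟩
      exact ⟨s, h⟩
    · rintro ⟨s, h⟩
      exact ⟨_, ⟨s, rfl⟩, h⟩

end Construction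

/-- There is a Δ⁰₄ set `S = [S]` which is proper on the infinite ceers and is neither
Σ⁰₃-hard nor Π⁰₃-hard with respect to many-one reducibility. -/
theorem exists_Delta04_closed_proper_not_Sigma03_or_Pi03_hard :
    ∃ S : Set ℕ, S = ceerClosure S ∧ IsDelta04 S ∧ ProperOnInfiniteCeers S ∧
      (∃ A : Set ℕ, IsSigma03 A ∧ ¬(· ∈ A) ≤₀ (· ∈ S)) ∧
      (∃ B : Set ℕ, IsPi03 B ∧ ¬(· ∈ B) ≤₀ (· ∈ S)) := by
  obtain ⟨A, hA, hA'⟩ := exists_sigmaPred_three_not_pi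
  obtain ⟨i, j, hi, hj, hij⟩ := exists_infinite_ceers_not_equiv
  obtain ⟨D, hD0, hcon, hD, hsig⟩ := exists_decision_sequence hA hA'
    (ρ := [Nat.bit true i, Nat.bit false j]) (by
      rintro ⟨k, ⟨d, hd, hdb, hdk⟩, d', hd', hdb', hdk'⟩
      have hdi : d = Nat.bit true i := by
        rcases List.mem_pair.1 hd with rfl | rfl
        · rfl
        · simp at hdb
      have hdj : d' = Nat.bit false j := by
        rcases List.mem_pair.1 hd' with rfl | rfl
        · simp at hdb'
        · rfl
      subst hdi hdj
      exact hij (by simpa using hdk'.symm.trans hdk))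
  have hmono : ∀ {s t}, s ≤ t → D s ⊆ D t := fun {s t} hst => by
    induction hst with
    | refl => exact List.Subset.refl _
    | step _ ih =>
      obtain ⟨d, hd, -⟩ := hD _
      rw [Nat.succ_eq_add_one, hd]
      exact List.subset_cons_of_subset _ ih
  let S : Set ℕ := {k | ∃ s, Decides true (D s) k}
  have hnot : ∀ {s k}, Decides false (D s) k → k ∉ S := by
    rintro s k h ⟨t, ht⟩
    exact hcon (max s t) ⟨k, ht.mono (hmono (le_max_right _ _)), h.mono (hmono (le_max_left _ _))⟩
  have hstage : ∀ s, ∃ d, Acts A s d ∧ (d.div2 ∈ S ↔ d.bodd = true) := fun s => by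
    obtain ⟨d, hd, h⟩ := hD s
    have hdec : Decides d.bodd (D (s + 1)) d.div2 := ⟨d, by simp [hd], rfl, CeerEquiv.refl _⟩
    refine ⟨d, h, fun hS => ?_, fun hb => ⟨s + 1, hb ▸ hdec⟩⟩
    by_contra hb
    exact hnot ((Bool.eq_false_iff.2 hb) ▸ hdec) hS
  have hcompl : ∀ k, k ∉ S ↔ ∃ s, Decides false (D s) k := fun k => by
    refine ⟨fun hk => ?_, fun ⟨s, h⟩ => hnot h⟩
    obtain ⟨d, hd, h⟩ := hD (Nat.pair 0 k)
    obtain rfl : d.div2 = k := by simpa [Acts] using h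
    have hdec : Decides d.bodd (D (Nat.pair 0 d.div2 + 1)) d.div2 :=
      ⟨d, by simp [hd], rfl, CeerEquiv.refl _⟩
    cases hb : d.bodd
    · exact ⟨_, hb ▸ hdec⟩
    · exact absurd ⟨_, hb ▸ hdec⟩ hk
  have hclosed : ceerClosure S ⊆ S := by
    rintro k ⟨l, ⟨s, hl⟩, hkl⟩
    exact ⟨s, hl.congr hkl⟩
  have hsub : S ⊆ ceerClosure S := fun k hk => ⟨k, hk, CeerEquiv.refl _⟩
  have hred : ∀ f : ℕ → ℕ, Computable f → ∀ k ≠ 0, ∃ n, n ∈ A ↔ (f n ∈ S ↔ k = 1) := by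
    intro f hf k hk
    obtain ⟨e, he⟩ := exists_code_of_computable hf
    obtain ⟨d, hd, hdS⟩ := hstage (Nat.pair k e)
    have htot : TotalCode e := fun n => ⟨f n, (he _ _).2 rfl⟩
    obtain ⟨n, hn, hnA⟩ : ∃ n, d.div2 = f n ∧ (n ∈ A ↔ (d.bodd = true ↔ k = 1)) := by
      simpa [Acts, hk, htot, he] using hd
    exact ⟨n, by rwa [← hn, hdS]⟩
  refine ⟨S, hsub.antisymm hclosed,
    ⟨(hsig true).isSigma04, SigmaPred.isSigma04 ((hsig false).of_eq fun k => (hcompl k).symm)⟩,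
    ⟨i, j, hi, hj, hsub ⟨0, ?_⟩, fun h => hnot (s := 0) ?_ (hclosed h)⟩, ?_, ?_⟩
  · exact ⟨Nat.bit true i, by simp [hD0], by simp, by simpa using CeerEquiv.refl _⟩
  · exact ⟨Nat.bit false j, by simp [hD0], by simp, by simpa using CeerEquiv.refl _⟩
  · refine ⟨A, hA.isSigma03, ?_⟩
    rintro ⟨f, hf, h⟩
    obtain ⟨n, hn⟩ := hred f hf 2 (by simp)
    have := h n
    simp at hn this
    tauto
  · refine ⟨Aᶜ, SigmaPred.isSigma03 (by simpa using hA), ?_⟩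
    rintro ⟨f, hf, h⟩
    obtain ⟨n, hn⟩ := hred f hf 1 (by simp)
    have := h n
    simp at hn this
    tauto
end
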